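/- Let d ≥ 2 and p ∈ (2, ∞). There exist a real r = r(p) > 1 and an infinite subset I ⊆ ℕ such that for every sequence (c_n)_{n∈ℕ} of nonnegative reals with c_n = 0 for all n ∉ I: if ∑_{n∈I} [ (1+n)^{−d(1/2 − 1/p)} c_n² ]^{r} < ∞, then the function x ↦ √( ∑_{n} c_n² · e_d(n, x) / D(d,n) ) belongs to L^p(ℝ^d). -/

import Mathlib

open MeasureTheory
open scoped ENNReal NNReal

/-- The `n`-th physicists' Hermite polynomial `H_n(x) = (−1)^n e^{x²} (d/dx)^n e^{−x²}`. -/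
noncomputable def hermitePoly (n : ℕ) (x : ℝ) : ℝ :=
  (-1 : ℝ) ^ n * Real.exp (x ^ 2) * iteratedDeriv n (fun t => Real.exp (-t ^ 2)) x

/-- The `n`-th (L²-normalized) Hermite function
`h_n(x) = H_n(x) e^{−x²/2} / √(n! 2^n √π)`. -/
noncomputable def hermiteFun (n : ℕ) (x : ℝ) : ℝ :=
  hermitePoly n x * Real.exp (-x ^ 2 / 2) /
    Real.sqrt ((n.factorial : ℝ) * 2 ^ n * Real.sqrt Real.pi)

/-- The spectral function of the `n`-th eigenspace of the harmonic oscillator `−Δ + |x|²`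
on `ℝ^d`: `e_d(n, x) = ∑_{i₁+⋯+i_d = n} h_{i₁}(x₁)² ⋯ h_{i_d}(x_d)²`. -/
noncomputable def eSpec (d n : ℕ) (x : Fin d → ℝ) : ℝ :=
  ∑ i ∈ Finset.Nat.antidiagonalTuple d n, ∏ k, (hermiteFun (i k) (x k)) ^ 2

/-- `D(d, n) = binom(n+d−1, d−1)`, the dimension of the `n`-th eigenspace. -/
def Ddim (d n : ℕ) : ℕ := Nat.choose (n + d - 1) (d - 1)

/-- The probabilistic Lebesgue norm `‖√(∑_n c_n² e_d(n,·)/D(d,n))‖_{L^p(ℝ^d)}`,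
computed in `[0, ∞]`. -/
noncomputable def hermitePLnorm (d : ℕ) (p : ℝ) (c : ℕ → ℝ) : ℝ≥0∞ :=
  (∫⁻ x : Fin d → ℝ,
      (∑' n : ℕ, ENNReal.ofReal ((c n) ^ 2 * eSpec d n x / (Ddim d n))) ^ (p / 2)
    ∂volume) ^ (1 / p)

section
noncomputable def lag : ℕ → ℝ → ℝ
  | 0, _ => 1
  | 1, t => 1 - t
  | (n+2), t => ((2 * n + 3 - t) * lag (n+1) t - (n+1) * lag n t) / (n+2)

noncomputable def lagd : ℕ → ℝ → ℝ
  | 0, _ => 0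
  | (n+1), t => lagd n t - lag n t

noncomputable def lagdd : ℕ → ℝ → ℝ
  | 0, _ => 0
  | (n+1), t => lagdd n t - lagd n t

lemma lag_rec (n : ℕ) (t : ℝ) :
    (n+2) * lag (n+2) t = (2 * n + 3 - t) * lag (n+1) t - (n+1) * lag n t := by
  have : (n + 2 : ℝ) ≠ 0 := by positivity
  rw [lag]; field_simp

lemma lagd_mul (n : ℕ) (t : ℝ) : t * lagd (n+1) t = (n+1) * (lag (n+1) t - lag n t) := by
  induction n with
  | zero => simp [lagd, lag]
  | succ k ih =>
    have h := lag_rec k t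
    have h2 : lagd (k+1+1) t = lagd (k+1) t - lag (k+1) t := rfl
    rw [h2, mul_sub, ih]; push_cast; linear_combination -h

lemma lag_hasDeriv (n : ℕ) (t : ℝ) : HasDerivAt (lag n) (lagd n t) t := by
  have key : ∀ n, HasDerivAt (lag n) (lagd n t) t ∧ HasDerivAt (lag (n+1)) (lagd (n+1) t) t := by
    intro n
    induction n with
    | zero =>
      constructor
      · exact hasDerivAt_const t 1
      · have := (hasDerivAt_id t).const_sub 1
        simpa [lagd, lag] using this
    | succ k ih =>
      refine ⟨ih.2, ?_⟩
      have h0 : HasDerivAt (fun t : ℝ => (2 * k + 3 - t)) (-1) t := by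
        simpa using (hasDerivAt_id t).const_sub (2 * k + 3 : ℝ)
      have h1 := ((h0.mul ih.2).sub (ih.1.const_mul (k+1 : ℝ))).div_const (k+2 : ℝ)
      have h2 : lagd (k+1+1) t = lagd (k+1) t - lag (k+1) t := rfl
      have h3 : lagd (k+1) t = lagd k t - lag k t := rfl
      have h4 := lagd_mul k t
      have hk : (k + 2 : ℝ) ≠ 0 := by positivity
      refine HasDerivAt.congr_deriv (f := lag (k+1+1)) h1 ?_
      rw [h2]; field_simp
      linear_combination -h4 + (k+1) * h3
  exact (key n).1

lemma lagd_hasDeriv (n : ℕ) (t : ℝ) : HasDerivAt (lagd n) (lagdd n t) t := by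
  induction n with
  | zero => exact hasDerivAt_const t 0
  | succ k ih => exact ih.sub (lag_hasDeriv k t)

lemma lag_ode (n : ℕ) (t : ℝ) : t * lagdd n t + (1 - t) * lagd n t + n * lag n t = 0 := by
  induction n with
  | zero => simp [lagd, lagdd]
  | succ k ih =>
    have h2 : lagd (k+1) t = lagd k t - lag k t := rfl
    have h3 : lagdd (k+1) t = lagdd k t - lagd k t := rfl
    have h4 := lagd_mul k t
    rw [h2] at h4
    rw [h2, h3]; push_cast; linear_combination ih - h4

lemma lag_zero_val (n : ℕ) : lag n 0 = 1 := by
  have h := lagd_mul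
  induction n with
  | zero => rfl
  | succ k ih =>
    have := h k 0
    have hk : (k + 1 : ℝ) ≠ 0 := by positivity
    rw [zero_mul, ih] at this
    have := (mul_eq_zero.1 this.symm).resolve_left hk
    linarith

noncomputable def psi (n : ℕ) (t : ℝ) : ℝ := Real.exp (-t/2) * lag n t
noncomputable def psid (n : ℕ) (t : ℝ) : ℝ := Real.exp (-t/2) * (lagd n t - lag n t / 2)
noncomputable def psidd (n : ℕ) (t : ℝ) : ℝ :=
  Real.exp (-t/2) * (lagdd n t - lagd n t + lag n t / 4)

lemma exp_half_deriv (t : ℝ) :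
    HasDerivAt (fun t : ℝ => Real.exp (-t/2)) (Real.exp (-t/2) * (-1/2)) t := by
  have : HasDerivAt (fun t : ℝ => -t/2) (-1/2) t := by
    simpa using (hasDerivAt_id t).neg.div_const 2
  exact this.exp

lemma psi_hasDeriv (n : ℕ) (t : ℝ) : HasDerivAt (psi n) (psid n t) t := by
  refine ((exp_half_deriv t).mul (lag_hasDeriv n t)).congr_deriv ?_
  simp only [psid]; ring

lemma psid_hasDeriv (n : ℕ) (t : ℝ) : HasDerivAt (psid n) (psidd n t) t := by
  refine ((exp_half_deriv t).mul ((lagd_hasDeriv n t).sub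
    ((lag_hasDeriv n t).div_const 2))).congr_deriv ?_
  simp only [psidd]
  simp only [Pi.sub_apply]
  ring

lemma psi_ode (n : ℕ) (t : ℝ) :
    t * psidd n t = - psid n t - (n + 1/2 - t/4) * psi n t := by
  have := lag_ode n t
  simp only [psi, psid, psidd]
  linear_combination (Real.exp (-t/2)) * this

lemma anti_of_deriv {f f' : ℝ → ℝ} {a b : ℝ} (hab : a ≤ b)
    (h : ∀ x ∈ Set.Icc a b, HasDerivAt f (f' x) x) (hn : ∀ x ∈ Set.Icc a b, f' x ≤ 0) :
    f b ≤ f a := by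
  have : AntitoneOn f (Set.Icc a b) := by
    apply antitoneOn_of_deriv_nonpos (convex_Icc a b)
    · intro x hx; exact (h x hx).continuousAt.continuousWithinAt
    · intro x hx; exact (h x (interior_subset hx)).differentiableAt.differentiableWithinAt
    · intro x hx; rw [(h x (interior_subset hx)).deriv]; exact hn x (interior_subset hx)
  exact this ⟨le_rfl, hab⟩ ⟨hab, le_rfl⟩ hab

lemma psi_H (n : ℕ) (t : ℝ) (ht : 0 ≤ t) :
    t * psid n t ^ 2 + (n + 1/2 - t/4) * psi n t ^ 2 ≤ n + 1/2 := by
  have h := anti_of_deriv (f := fun t => t * psid n t ^ 2 + (n + 1/2 - t/4) * psi n t ^ 2)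
    (f' := fun t => - psid n t ^ 2 - psi n t ^ 2 / 4) ht ?_ ?_
  · have h0 : psi n 0 = 1 := by simp [psi, lag_zero_val]
    simpa [h0] using h
  · intro x _
    have h1 := psi_hasDeriv n x
    have h2 := psid_hasDeriv n x
    have h3 : HasDerivAt (fun t : ℝ => (n + 1/2 - t/4 : ℝ)) (-(1/4)) x := by
      simpa using ((hasDerivAt_id x).div_const 4).const_sub (n + 1/2 : ℝ)
    refine (((hasDerivAt_id x).mul (h2.pow 2)).add (h3.mul (h1.pow 2))).congr_deriv ?_
    have := psi_ode n x
    simp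
    linear_combination 2 * psid n x * this
  · intro x _
    nlinarith [sq_nonneg (psid n x), sq_nonneg (psi n x)]

lemma psi_S (n : ℕ) (t0 t : ℝ) (ht0 : 0 < t0) (ht : t0 ≤ t) :
    Real.sqrt t * (4 * t * psid n t ^ 2 + 2 * psi n t * psid n t
      + (4 * n + 2 - t + 1/(2*t)) * psi n t ^ 2) ≤
    Real.sqrt t0 * (4 * t0 * psid n t0 ^ 2 + 2 * psi n t0 * psid n t0
      + (4 * n + 2 - t0 + 1/(2*t0)) * psi n t0 ^ 2) := by
  refine anti_of_deriv (f := fun t => Real.sqrt t * (4 * t * psid n t ^ 2 + 2 * psi n t * psid n t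
      + (4 * n + 2 - t + 1/(2*t)) * psi n t ^ 2))
    (f' := fun t => - (Real.sqrt t * (1 + 1/(4*t^2)) * psi n t ^ 2)) ht ?_ ?_
  · intro x hx
    have hx0 : 0 < x := lt_of_lt_of_le ht0 hx.1
    have h1 := psi_hasDeriv n x
    have h2 := psid_hasDeriv n x
    have h4 := Real.hasDerivAt_sqrt hx0.ne'
    have h3 : HasDerivAt (fun t : ℝ => (4 * n + 2 - t + 1/(2*t) : ℝ)) (-1 - 1/(2*x^2)) x := by
      have := ((hasDerivAt_id x).const_sub (4 * n + 2 : ℝ)).add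
        (((hasDerivAt_id x).const_mul 2).inv (by simpa using hx0.ne'))
      simp only [one_div]
      refine this.congr_deriv ?_
      simp; field_simp; ring
    have h5 := h4.mul (((((hasDerivAt_id x).const_mul 4).mul (h2.pow 2)).add
      ((h1.const_mul 2).mul h2)).add (h3.mul (h1.pow 2)))
    refine h5.congr_deriv ?_
    have hode := psi_ode n x
    have hdd : psidd n x = (- psid n x - (n + 1/2 - x/4) * psi n x) / x := by
      rw [eq_div_iff hx0.ne']; linear_combination hode
    simp
    rw [hdd]
    have hs : Real.sqrt x ^ 2 = x := Real.sq_sqrt hx0.le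
    have hs0 : Real.sqrt x ≠ 0 := by positivity
    set r := Real.sqrt x
    rw [← hs]
    field_simp
    ring
  · intro x hx
    have hx0 : 0 < x := lt_of_lt_of_le ht0 hx.1
    have : 0 ≤ Real.sqrt x * (1 + 1/(4*x^2)) * psi n x ^ 2 := by positivity
    linarith

lemma psi_bulk (n : ℕ) (t : ℝ) (ht : 1 / (n + 1 : ℝ) ≤ t) :
    Real.sqrt t * (4 * n + 2 - t) * psi n t ^ 2 ≤ 16 * Real.sqrt (n + 1) := by
  have hN : (1:ℝ) ≤ n + 1 := by linarith [(Nat.cast_nonneg n : (0:ℝ) ≤ n)]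
  have hn0 : (0:ℝ) ≤ n := Nat.cast_nonneg n
  obtain ⟨t0, ht0⟩ : ∃ t0 : ℝ, t0 = 1 / (n + 1 : ℝ) := ⟨_, rfl⟩
  have ht0p : 0 < t0 := by rw [ht0]; positivity
  have hNt : (n + 1) * t0 = 1 := by rw [ht0]; field_simp
  have ht01 : t0 ≤ 1 := by nlinarith
  have hS := psi_S n t0 t ht0p (ht0 ▸ ht)
  have hH := psi_H n t0 ht0p.le
  have htp : 0 < t := lt_of_lt_of_le ht0p (ht0 ▸ ht)
  have e1 : (1/(2*t0)) = (n+1)/2 := by rw [ht0]; field_simp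
  rw [e1] at hS
  have hA : psi n t0 ^ 2 ≤ 2 := by
    nlinarith [mul_nonneg ht0p.le (sq_nonneg (psid n t0)), sq_nonneg (psi n t0)]
  have hB : t0 * psid n t0 ^ 2 ≤ n + 1 := by
    nlinarith [sq_nonneg (psi n t0)]
  have hC : 2 * psi n t0 * psid n t0 ≤ 3 * (n + 1) := by
    have : 2 * psi n t0 * psid n t0 ≤ (n+1) * psi n t0 ^ 2 + t0 * psid n t0 ^ 2 := by
      have h := mul_nonneg (by linarith : (0:ℝ) ≤ n + 1) (sq_nonneg (psi n t0 - t0 * psid n t0))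
      have e : (n+1) * (psi n t0 - t0 * psid n t0)^2 = (n+1) * psi n t0 ^ 2 + t0 * psid n t0 ^ 2
        - 2 * psi n t0 * psid n t0 := by
        linear_combination (-2 * psi n t0 * psid n t0 + t0 * psid n t0 ^ 2) * hNt
      linarith
    nlinarith
  have hD : 4 * t0 * psid n t0 ^ 2 + 2 * psi n t0 * psid n t0
      + (4 * n + 2 - t0 + (n+1)/2) * psi n t0 ^ 2 ≤ 16 * (n+1) := by
    have : (4 * n + 2 - t0 + (n+1)/2) * psi n t0 ^ 2 ≤ (4 * (n+1) + (n+1)/2) * 2 := by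
      apply mul_le_mul _ hA (sq_nonneg _) (by linarith)
      linarith
    nlinarith
  have hE : Real.sqrt t0 * (16 * (n+1)) = 16 * Real.sqrt (n+1) := by
    rw [ht0, one_div, Real.sqrt_inv]
    have : Real.sqrt (n+1 : ℝ) ≠ 0 := by positivity
    field_simp
    rw [Real.sq_sqrt (by linarith)]
  have hF : Real.sqrt t * (4 * n + 2 - t) * psi n t ^ 2 ≤
      Real.sqrt t * (4 * t * psid n t ^ 2 + 2 * psi n t * psid n t
      + (4 * n + 2 - t + 1/(2*t)) * psi n t ^ 2) := by
    rw [mul_assoc]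
    apply mul_le_mul_of_nonneg_left _ (Real.sqrt_nonneg t)
    have : 0 ≤ 4 * t * psid n t ^ 2 + 2 * psi n t * psid n t + 1/(2*t) * psi n t ^ 2 := by
      have : 4 * t * psid n t ^ 2 + 2 * psi n t * psid n t + 1/(2*t) * psi n t ^ 2
        = t * (2 * psid n t + psi n t / (2*t))^2 + 1/(4*t) * psi n t ^ 2 := by
        field_simp; ring
      rw [this]; positivity
    linarith
  calc _ ≤ _ := hF
    _ ≤ _ := hS
    _ ≤ Real.sqrt t0 * (16 * (n+1)) := mul_le_mul_of_nonneg_left hD (Real.sqrt_nonneg _)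
    _ = _ := hE

end

section
noncomputable def vv (n : ℕ) (t : ℝ) : ℝ := (n+1) * (psi n t - psi (n+1) t)
noncomputable def pp (n : ℕ) (t : ℝ) : ℝ := (n+1) * (psi n t + psi (n+1) t) / 2
noncomputable def FF (n : ℕ) (t : ℝ) : ℝ := ∑ k ∈ Finset.range (n+1), (-1)^k * psi k t

lemma vv_hasDeriv (n : ℕ) (t : ℝ) : HasDerivAt (vv n) (pp n t) t := by
  refine (((psi_hasDeriv n t).sub (psi_hasDeriv (n+1) t)).const_mul (n+1 : ℝ)).congr_deriv ?_
  have h2 : lagd (n+1) t = lagd n t - lag n t := rfl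
  simp only [psid, pp, psi, h2]; ring

lemma pp_hasDeriv (n : ℕ) (t : ℝ) (ht : 0 < t) :
    HasDerivAt (pp n) (-((n + 1 - t/4) * vv n t / t)) t := by
  refine ((((psi_hasDeriv n t).add (psi_hasDeriv (n+1) t)).const_mul
    (n+1 : ℝ)).div_const 2).congr_deriv ?_
  have h2 : lagd (n+1) t = lagd n t - lag n t := rfl
  have h3 := lagd_mul n t
  rw [← neg_div, eq_div_iff ht.ne']
  simp only [psid, vv, psi]
  linear_combination (n + 1 : ℝ) * Real.exp (-t/2) * h3 + -(n+1 : ℝ)/2 * t * Real.exp (-t/2) * h2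

lemma FF_deriv_aux (n : ℕ) (t : ℝ) :
    ∑ k ∈ Finset.range (n+1), (-1 : ℝ)^k * psid k t
      = (-1)^n * Real.exp (-t/2) * lagd (n+1) t / 2 := by
  induction n with
  | zero => simp [psid, lagd, lag]; ring
  | succ k ih =>
    rw [Finset.sum_range_succ, ih]
    have h2 : lagd (k+1+1) t = lagd (k+1) t - lag (k+1) t := rfl
    rw [h2, pow_succ, psid]; ring

lemma FF_hasDeriv (n : ℕ) (t : ℝ) (ht : 0 < t) :
    HasDerivAt (FF n) (-((-1)^n * vv n t / (2 * t))) t := by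
  have h : HasDerivAt (FF n) (∑ k ∈ Finset.range (n+1), (-1 : ℝ)^k * psid k t) t := by
    have := HasDerivAt.fun_sum (u := Finset.range (n+1))
      (A := fun k t => (-1 : ℝ)^k * psi k t) (A' := fun k => (-1 : ℝ)^k * psid k t) (x := t)
      (fun k _ => (psi_hasDeriv k t).const_mul _)
    exact this
  refine h.congr_deriv ?_
  rw [FF_deriv_aux, vv, psi, psi]
  have h3 := lagd_mul n t
  field_simp
  linear_combination h3

lemma FF_cont (n : ℕ) : Continuous (FF n) := by
  unfold FF
  refine continuous_finsetSum _ (fun k _ => continuous_const.mul ?_)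
  exact continuous_iff_continuousAt.2 (fun t => (psi_hasDeriv k t).continuousAt)

lemma psi_cont (n : ℕ) : Continuous (psi n) :=
  continuous_iff_continuousAt.2 (fun t => (psi_hasDeriv n t).continuousAt)

lemma FF_zero (n : ℕ) : |FF n 0| ≤ 1 := by
  have h0 : ∀ k, psi k 0 = 1 := by intro k; simp [psi, lag_zero_val]
  unfold FF
  simp only [h0, mul_one]
  rw [neg_one_geom_sum]
  split_ifs <;> simp

lemma psi_abs (n : ℕ) (t : ℝ) (ht : 0 ≤ t) (h : t ≤ 2 * n + 1) : psi n t ^ 2 ≤ 2 := by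
  have hH := psi_H n t ht
  have : 0 ≤ t * psid n t ^ 2 := by positivity
  have hn0 : (0:ℝ) ≤ n := Nat.cast_nonneg n
  nlinarith [sq_nonneg (psi n t)]

lemma pp_abs (n : ℕ) (t : ℝ) (ht : 0 ≤ t) (h : t ≤ n + 1) : |pp n t| ≤ 2 * (n + 1) := by
  have hn0 : (0:ℝ) ≤ n := Nat.cast_nonneg n
  have h1 := psi_abs n t ht (by linarith)
  have h2 := psi_abs (n+1) t ht (by push_cast; linarith)
  have h3 : |psi n t| ≤ 2 := by apply abs_le_of_sq_le_sq <;> nlinarith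
  have h4 : |psi (n+1) t| ≤ 2 := by apply abs_le_of_sq_le_sq <;> nlinarith
  have h5 : |psi n t + psi (n+1) t| ≤ 4 := (abs_add_le _ _).trans (by linarith)
  rw [pp, abs_div, abs_mul, abs_of_nonneg (by linarith : (0:ℝ) ≤ n + 1), abs_two]
  nlinarith

lemma abs_sub_of_deriv {f f' g g' : ℝ → ℝ} {a b : ℝ} (hab : a ≤ b)
    (hfc : ContinuousOn f (Set.Icc a b)) (hgc : ContinuousOn g (Set.Icc a b))
    (hf : ∀ x ∈ Set.Ioo a b, HasDerivAt f (f' x) x)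
    (hg : ∀ x ∈ Set.Ioo a b, HasDerivAt g (g' x) x)
    (hb : ∀ x ∈ Set.Ioo a b, |f' x| ≤ g' x) : |f b - f a| ≤ g b - g a := by
  have h1 : MonotoneOn (g - f) (Set.Icc a b) := by
    apply monotoneOn_of_deriv_nonneg (convex_Icc a b) (hgc.sub hfc)
    · intro x hx; rw [interior_Icc] at hx
      exact ((hg x hx).sub (hf x hx)).differentiableAt.differentiableWithinAt
    · intro x hx; rw [interior_Icc] at hx
      rw [((hg x hx).sub (hf x hx)).deriv]
      linarith [le_abs_self (f' x), hb x hx]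
  have h2 : MonotoneOn (g + f) (Set.Icc a b) := by
    apply monotoneOn_of_deriv_nonneg (convex_Icc a b) (hgc.add hfc)
    · intro x hx; rw [interior_Icc] at hx
      exact ((hg x hx).add (hf x hx)).differentiableAt.differentiableWithinAt
    · intro x hx; rw [interior_Icc] at hx
      rw [((hg x hx).add (hf x hx)).deriv]
      linarith [neg_abs_le (f' x), hb x hx]
  have e1 := h1 ⟨le_rfl, hab⟩ ⟨hab, le_rfl⟩ hab
  have e2 := h2 ⟨le_rfl, hab⟩ ⟨hab, le_rfl⟩ hab
  simp only [Pi.sub_apply, Pi.add_apply] at e1 e2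
  rw [abs_le]; constructor <;> linarith

lemma pp_cont (n : ℕ) : Continuous (pp n) := by
  unfold pp
  have := psi_cont n
  have := psi_cont (n+1)
  fun_prop

lemma abs_negone_mul (n : ℕ) (x : ℝ) : |(-1)^n * x| = |x| := by
  rw [abs_mul, abs_pow]; simp

lemma FF_step1 (n : ℕ) (t : ℝ) (ht : 0 ≤ t) (h : t ≤ n + 1) : |FF n t| ≤ 6 := by
  have hn0 : (0:ℝ) ≤ n := Nat.cast_nonneg n
  have hpos : ∀ x ≤ t, (3/4 : ℝ) * (n+1) ≤ n + 1 - x/4 := fun x hx => by linarith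
  have key := abs_sub_of_deriv (f := fun x => FF n x - (-1)^n * pp n x / (2 * (n + 1 - x/4)))
    (f' := fun x => - ((-1)^n * pp n x / (8 * (n+1-x/4)^2)))
    (g := fun x => x / (n+1)) (g' := fun _ => 1 / (n+1)) ht ?_ ?_ ?_ ?_ ?_
  · simp only [zero_div, sub_zero] at key
    have h0 := FF_zero n
    have hp0 := pp_abs n 0 le_rfl (by linarith)
    have hpt := pp_abs n t ht h
    have e1 : |(-1)^n * pp n t / (2 * (n + 1 - t/4))| ≤ 4/3 := by
      have := hpos t le_rfl
      rw [abs_div, abs_negone_mul, abs_of_pos (a := 2 * (n + 1 - t/4)) (by linarith), div_le_iff₀ (by linarith)]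
      linarith
    have e2 : |(-1)^n * pp n 0 / (2 * (n + 1 : ℝ))| ≤ 4/3 := by
      rw [abs_div, abs_negone_mul, abs_of_pos (a := 2 * (n + 1 : ℝ)) (by linarith), div_le_iff₀ (by linarith)]
      linarith
    have e3 : t / (n+1 : ℝ) ≤ 1 := by rw [div_le_one (by linarith)]; exact h
    rw [abs_le] at *
    constructor <;> linarith [key.1, key.2, h0.1, h0.2, e1.1, e1.2, e2.1, e2.2]
  · refine (FF_cont n).continuousOn.sub (ContinuousOn.div ?_ ?_ ?_)
    · exact (continuous_const.mul (pp_cont n)).continuousOn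
    · fun_prop
    · intro x hx; have := hpos x hx.2; apply ne_of_gt; linarith
  · fun_prop
  · intro x hx
    have := hpos x hx.2.le
    have h1 : HasDerivAt (fun x : ℝ => (2 * (n + 1 - x/4) : ℝ)) (-(1/2)) x := by
      refine ((((hasDerivAt_id x).div_const 4).const_sub (n + 1 : ℝ)).const_mul 2).congr_deriv ?_
      norm_num
    have hx0 : x ≠ 0 := hx.1.ne'
    have hne : (n + 1 - x/4 : ℝ) ≠ 0 := by apply ne_of_gt; linarith
    refine ((FF_hasDeriv n x hx.1).sub ((((pp_hasDeriv n x hx.1).const_mul ((-1)^n)).div h1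
      (by apply ne_of_gt; linarith)))).congr_deriv ?_
    generalize hY : (n + 1 - x/4 : ℝ) = Y at *
    field_simp
    ring
  · intro x hx
    exact (hasDerivAt_id x).div_const _
  · intro x hx
    have := hpos x hx.2.le
    have hp := pp_abs n x hx.1.le (by linarith [hx.2])
    rw [abs_neg, abs_div, abs_negone_mul, abs_of_nonneg (by positivity : (0:ℝ) ≤ 8 * (n+1-x/4)^2),
      div_le_div_iff₀ (by apply mul_pos; norm_num; apply pow_pos; linarith) (by linarith)]
    nlinarith

end

section
/-- quartic root profile -/
noncomputable def mm (N D t : ℝ) : ℝ := Real.sqrt (Real.sqrt (N + D^4 - t/4))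

lemma mm_pow (N D t : ℝ) (h : 0 ≤ N + D^4 - t/4) : mm N D t ^ 4 = N + D^4 - t/4 := by
  unfold mm
  rw [show (4:ℕ) = 2 * 2 by norm_num, pow_mul, Real.sq_sqrt (Real.sqrt_nonneg _), Real.sq_sqrt h]

lemma mm_pos (N D t : ℝ) (h : 0 < N + D^4 - t/4) : 0 < mm N D t := by
  unfold mm; positivity

lemma mm_hasDeriv (N D t : ℝ) (h : 0 < N + D^4 - t/4) :
    HasDerivAt (mm N D) (-(1 / (16 * mm N D t ^ 3))) t := by
  have h1 : HasDerivAt (fun t : ℝ => N + D^4 - t/4) (-(1/4)) t := by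
    simpa using ((hasDerivAt_id t).div_const 4).const_sub (N + D^4)
  have h2 := (h1.sqrt h.ne').sqrt (by positivity)
  refine h2.congr_deriv ?_
  unfold mm
  have hs : 0 < Real.sqrt (N + D^4 - t/4) := by positivity
  have e : Real.sqrt (N + D^4 - t/4) = Real.sqrt (Real.sqrt (N + D^4 - t/4)) ^ 2 :=
    (Real.sq_sqrt hs.le).symm
  have hs2 : 0 < Real.sqrt (Real.sqrt (N + D^4 - t/4)) := by positivity
  set r := Real.sqrt (Real.sqrt (N + D^4 - t/4))
  rw [e]
  field_simp
  norm_num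

noncomputable def BB (n : ℕ) (D t : ℝ) : ℝ :=
  pp n t ^ 2 / mm (n+1) D t ^ 2 - vv n t * pp n t / (8 * mm (n+1) D t ^ 6)
    + (3 / (128 * mm (n+1) D t ^ 10) + (n + 1 - t/4) / (t * mm (n+1) D t ^ 2)) * vv n t ^ 2

lemma BB_hasDeriv (n : ℕ) (D t : ℝ) (ht : 0 < t) (h : 0 < (n + 1 : ℝ) + D^4 - t/4) :
    HasDerivAt (BB n D) ((15 / (1024 * mm (n+1) D t ^ 14)
      - ((t/2 - 2 * (n+1))^2 + 4 * (n+1) * D^4) / (4 * mm (n+1) D t ^ 6 * t^2)) * vv n t ^ 2) t := by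
  have hm := mm_hasDeriv (n+1) D t h
  have hmp := mm_pos (n+1) D t h
  have hm4 := mm_pow (n+1) D t h.le
  have hv := vv_hasDeriv n t
  have hp := pp_hasDeriv n t ht
  have hq : HasDerivAt (fun t : ℝ => (n + 1 - t/4 : ℝ)) (-(1/4)) t := by
    simpa using ((hasDerivAt_id t).div_const 4).const_sub (n + 1 : ℝ)
  have d1 := (hp.pow 2).div (hm.pow 2) (pow_ne_zero 2 hmp.ne')
  have d2 := (hv.mul hp).div ((hm.pow 6).const_mul 8) (mul_ne_zero (by norm_num) (pow_ne_zero 6 hmp.ne'))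
  have d3 := (hasDerivAt_const t (3:ℝ)).div ((hm.pow 10).const_mul 128) (mul_ne_zero (by norm_num) (pow_ne_zero 10 hmp.ne'))
  have d4 := hq.div ((hasDerivAt_id t).mul (hm.pow 2)) (by simp; exact ⟨ht.ne', hmp.ne'⟩)
  have d5 := (d1.sub d2).add ((d3.add d4).mul (hv.pow 2))
  refine d5.congr_deriv ?_
  have hD : D^4 = mm (n+1) D t ^ 4 - (n+1) + t/4 := by rw [hm4]; ring
  simp only [Pi.pow_apply, Pi.mul_apply, Pi.add_apply, Pi.div_apply, id]
  rw [hD]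
  generalize mm (n+1) D t = m at *
  generalize vv n t = v at *
  generalize pp n t = p at *
  norm_num
  field_simp
  ring

lemma BB_anti (n : ℕ) (D t : ℝ) (hD : 0 < D) (hDN : D^12 = n + 1) (h1 : (n + 1 : ℝ) ≤ t)
    (h2 : t ≤ 4 * (n+1)) : BB n D t ≤ BB n D (n+1) := by
  have hn0 : (0:ℝ) ≤ n := Nat.cast_nonneg n
  have hD4 : 0 < D^4 := by positivity
  refine anti_of_deriv h1 (fun x hx => BB_hasDeriv n D x (by linarith [hx.1])
    (by linarith [hx.2])) ?_
  intro x hx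
  have hX : 0 < (n + 1 : ℝ) + D^4 - x/4 := by linarith [hx.2]
  have hmp := mm_pos (n+1) D x hX
  have hm4 := mm_pow (n+1) D x hX.le
  have hx0 : 0 < x := by linarith [hx.1]
  apply mul_nonpos_of_nonpos_of_nonneg _ (sq_nonneg _)
  have hmD : D^4 ≤ mm (n+1) D x ^ 4 := by rw [hm4]; linarith [hx.2]
  have hx4 : x ≤ 4 * (n+1) := hx.2.trans h2
  generalize mm (n+1) D x = m at *
  rw [sub_nonpos, div_le_div_iff₀ (by positivity) (by positivity)]
  have e1 : D^8 ≤ m^8 := by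
    have := pow_le_pow_left₀ hD4.le hmD 2
    ring_nf at this ⊢; linarith
  have e2 : (n+1 : ℝ) ≤ D^4 * m^8 := by
    rw [← hDN]
    calc D^12 = D^4 * D^8 := by ring
      _ ≤ D^4 * m^8 := by gcongr
  have e3 : x^2 ≤ 16 * (n+1)^2 := by nlinarith
  have e4 : 15 * x^2 ≤ 1024 * (n+1) * (D^4 * m^8) := by nlinarith
  have e5 : 15 * (4 * m^6 * x^2) ≤ 4 * (n+1) * D^4 * (1024 * m^14) := by
    have := mul_le_mul_of_nonneg_left e4 (by positivity : 0 ≤ 4 * m^6)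
    calc _ = 4 * m^6 * (15 * x^2) := by ring
      _ ≤ _ := this
      _ = _ := by ring
  have e6 : 0 ≤ (x/2 - 2 * (n+1))^2 * (1024 * m^14) := by positivity
  linarith

lemma start_bound (n : ℕ) : psi n (n+1) ^ 2 ≤ 32 / (n+1) ∧ psi (n+1) (n+1) ^ 2 ≤ 32 / (n+1) := by
  have hn0 : (0:ℝ) ≤ n := Nat.cast_nonneg n
  have hs : 0 < Real.sqrt (n+1 : ℝ) := by positivity
  constructor
  · have h := psi_bulk n (n+1) (by rw [div_le_iff₀ (by linarith)]; nlinarith)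
    rw [le_div_iff₀ (by linarith)]
    have h' : Real.sqrt (n+1) * ((3 * n + 1) * psi n (n+1) ^ 2) ≤ Real.sqrt (n+1) * 16 := by
      linarith
    have := le_of_mul_le_mul_left h' hs
    nlinarith [sq_nonneg (psi n (n+1))]
  · have h := psi_bulk (n+1) (n+1) (by push_cast; rw [div_le_iff₀ (by linarith)]; nlinarith)
    rw [le_div_iff₀ (by linarith)]
    push_cast at h
    have h2 : Real.sqrt (n + 1 + 1) ≤ Real.sqrt (n+1) * 2 := by
      rw [Real.sqrt_le_left (by positivity), mul_pow, Real.sq_sqrt (by linarith)]; linarith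
    have h' : Real.sqrt (n+1) * ((3 * n + 5) * psi (n+1) (n+1) ^ 2) ≤ Real.sqrt (n+1) * 32 := by
      linarith
    have := le_of_mul_le_mul_left h' hs
    nlinarith [sq_nonneg (psi (n+1) (n+1))]

lemma BB_start (n : ℕ) (D : ℝ) (hD : 1 ≤ D) (hDN : D^12 = n + 1) :
    BB n D (n+1) ≤ 400 * D^6 := by
  have hn0 : (0:ℝ) ≤ n := Nat.cast_nonneg n
  obtain ⟨ha, hb⟩ := start_bound n
  have hD4 : 1 ≤ D^4 := one_le_pow₀ hD
  have hX : 0 < (n + 1 : ℝ) + D^4 - (n+1)/4 := by linarith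
  have hmp := mm_pos (n+1) D (n+1) hX
  have hm4 := mm_pow (n+1) D (n+1) hX.le
  have hN1 : (0:ℝ) < n + 1 := by linarith
  rw [le_div_iff₀ hN1] at ha hb
  have hv : vv n (n+1) ^ 2 ≤ 128 * (n+1) := by
    unfold vv
    have h1 : 0 ≤ (n+1 : ℝ)^2 * (psi n (n+1) + psi (n+1) (n+1))^2 := by positivity
    have h2 := mul_le_mul_of_nonneg_left (add_le_add ha hb) hN1.le
    nlinarith
  have hp : pp n (n+1) ^ 2 ≤ 32 * (n+1) := by
    unfold pp
    have h1 : 0 ≤ (n+1 : ℝ)^2 * (psi n (n+1) - psi (n+1) (n+1))^2 := by positivity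
    have h2 := mul_le_mul_of_nonneg_left (add_le_add ha hb) hN1.le
    nlinarith
  unfold BB
  generalize mm (n+1) D (n+1) = m at *
  generalize vv n (n+1) = v at *
  generalize pp n (n+1) = p at *
  have hm1 : 1 ≤ m^4 := by rw [hm4]; linarith
  have hm8 : 1 ≤ m^8 := by have := one_le_pow₀ hm1 (n := 2); ring_nf at this ⊢; linarith
  have hmN : D^12 * (3/4) ≤ m^4 := by rw [hm4, hDN]; linarith
  have hmD : D^6 ≤ 2 * m^2 := by
    have : (D^6)^2 ≤ (2 * m^2)^2 := by ring_nf; ring_nf at hmN; nlinarith [pow_pos hmp 4]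
    exact (abs_le_of_sq_le_sq' this (by positivity)).2
  have e1 : p^2 / m^2 - v * p / (8 * m^6) + (3 / (128 * m^10) + (n + 1 - (n+1)/4) / ((n+1) * m^2)) * v^2
    = (p^2 - v * p / (8 * m^4) + (3 / (128 * m^8) + 3/4) * v^2) / m^2 := by
    field_simp; ring
  rw [e1, div_le_iff₀ (by positivity)]
  have e2 : - (v * p / (8 * m^4)) ≤ (v^2 + p^2) / 16 := by
    rw [← neg_div, div_le_div_iff₀ (by positivity) (by norm_num)]
    nlinarith [sq_nonneg (v+p), sq_nonneg v, sq_nonneg p]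
  have e3 : 3 / (128 * m^8) ≤ 3/128 := by
    rw [div_le_div_iff₀ (by positivity) (by norm_num)]; linarith
  have e4 : (3 / (128 * m^8) + 3/4) * v^2 ≤ (3/128 + 3/4) * v^2 := by gcongr
  have e5 : (n+1 : ℝ) ≤ 2 * (D^6 * m^2) := by
    rw [← hDN]
    calc D^12 = D^6 * D^6 := by ring
      _ ≤ D^6 * (2 * m^2) := by gcongr
      _ = _ := by ring
  nlinarith

lemma edge_bounds (n : ℕ) (D t : ℝ) (hD : 1 ≤ D) (hDN : D^12 = n + 1) (h1 : (n + 1 : ℝ) ≤ t)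
    (h2 : t ≤ 4 * (n+1)) : |pp n t| ≤ 30 * D^3 * mm (n+1) D t ∧
      |vv n t| ≤ 500 * D^9 / mm (n+1) D t := by
  have hn0 : (0:ℝ) ≤ n := Nat.cast_nonneg n
  have hD0 : 0 < D := by linarith
  have hB := (BB_anti n D t hD0 hDN h1 h2).trans (BB_start n D hD hDN)
  have hD4 : 0 < D^4 := by positivity
  have hX : 0 < (n + 1 : ℝ) + D^4 - t/4 := by linarith
  have hmp := mm_pos (n+1) D t hX
  have hm4 := mm_pow (n+1) D t hX.le
  have ht : 0 < t := by linarith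
  unfold BB at hB
  have hq : n + 1 - t/4 = mm (n+1) D t ^ 4 - D^4 := by rw [hm4]; ring
  have hq0 : 0 ≤ mm (n+1) D t ^ 4 - D^4 := by rw [hm4]; linarith
  rw [hq] at hB
  generalize mm (n+1) D t = m at *
  generalize vv n t = v at *
  generalize pp n t = p at *
  have hB2 : p^2 - v * p / (8 * m^4) + (3 / (128 * m^8) + (m^4 - D^4)/t) * v^2 ≤ 400 * D^6 * m^2 := by
    have := mul_le_mul_of_nonneg_right hB (by positivity : 0 ≤ m^2)
    refine le_trans (le_of_eq ?_) this
    field_simp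
  obtain ⟨y, hy⟩ : ∃ y, v = y * m^4 := ⟨v / m^4, by field_simp⟩
  have hB3 : p^2 - y * p / 8 + 3/128 * y^2 + (m^4 - D^4)/t * v^2 ≤ 400 * D^6 * m^2 := by
    refine le_trans (le_of_eq ?_) hB2
    rw [hy]; field_simp; ring
  have hQ : 0 ≤ (m^4 - D^4)/t * v^2 := by positivity
  have hp2 : p^2 ≤ 800 * D^6 * m^2 := by nlinarith [sq_nonneg (p - y/8), sq_nonneg y]
  have hv2 : y^2/64 + (m^4 - D^4)/t * v^2 ≤ 400 * D^6 * m^2 := by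
    nlinarith [sq_nonneg (p - y/8), sq_nonneg p]
  constructor
  · apply abs_le_of_sq_le_sq _ (by positivity)
    nlinarith [mul_pos (pow_pos hD0 6) (pow_pos hmp 2)]
  · have key : m^4 * v^2 ≤ 512 * D^12 * (400 * D^6 * m^2) := by
      refine le_trans ?_ (mul_le_mul_of_nonneg_left hv2 (by positivity : 0 ≤ 512 * D^12))
      rcases le_total (2 * D^4) (m^4) with hc | hc
      · have : m^4 / (8 * D^12) ≤ (m^4 - D^4)/t := by
          rw [hDN, div_le_div_iff₀ (by linarith) ht]
          have : m^4 * t ≤ m^4 * (4 * (n+1)) := by gcongr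
          nlinarith
        have h3 := mul_le_mul_of_nonneg_right this (sq_nonneg v)
        have h4 : m^4 * v^2 = 8 * D^12 * (m^4 / (8 * D^12) * v^2) := by field_simp
        rw [h4]
        have : 0 ≤ y^2/64 := by positivity
        nlinarith [pow_pos hD0 12]
      · have h5 : (m^4)^3 ≤ (2 * D^4)^3 := pow_le_pow_left₀ (by positivity) hc 3
        have h6 : m^4 * v^2 = (m^4)^3 * y^2 := by rw [hy]; ring
        rw [h6]
        have : (m^4)^3 * y^2 ≤ (2 * D^4)^3 * y^2 := by gcongr
        have h8 : (2 * D^4)^3 * y^2 = 512 * D^12 * (y^2/64) := by ring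
        have : 0 ≤ 512 * D^12 * ((m^4 - D^4)/t * v^2) := by positivity
        nlinarith
    apply abs_le_of_sq_le_sq _ (by positivity)
    rw [div_pow, le_div_iff₀ (by positivity)]
    have h9 : m^2 * (v^2 * m^2) ≤ m^2 * (204800 * D^18) := by nlinarith
    have := le_of_mul_le_mul_left h9 (by positivity)
    have h10 : (500 * D^9)^2 = 250000 * D^18 := by ring
    rw [h10]
    linarith [pow_pos hD0 18]

lemma FF_step2 (n : ℕ) (t : ℝ) (h1 : (n + 1 : ℝ) ≤ t) (h2 : t ≤ 4 * (n+1)) :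
    |FF n t| ≤ 6000 := by
  have hn0 : (0:ℝ) ≤ n := Nat.cast_nonneg n
  obtain ⟨D, hD, hDN⟩ : ∃ D : ℝ, 1 ≤ D ∧ D^12 = n + 1 := by
    refine ⟨(n + 1 : ℝ) ^ (1/12 : ℝ), Real.one_le_rpow (by linarith) (by norm_num), ?_⟩
    rw [← Real.rpow_natCast, ← Real.rpow_mul (by linarith)]; norm_num
  have hD0 : 0 < D := by linarith
  have hD4 : 0 < D^4 := by positivity
  have hX : ∀ x ≤ t, 0 < (n + 1 : ℝ) + D^4 - x/4 := fun x hx => by linarith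
  have hmD : ∀ x ≤ t, D ≤ mm (n+1) D x := by
    intro x hx
    have hm4 := mm_pow (n+1) D x (hX x hx).le
    have hmp := mm_pos (n+1) D x (hX x hx)
    apply le_of_pow_le_pow_left₀ (n := 4) (by norm_num) hmp.le
    rw [hm4]; linarith
  have hpX : ∀ x, (n+1 : ℝ) ≤ x → x ≤ t → |(-1)^n * pp n x / (2 * mm (n+1) D x ^ 4)| ≤ 15 := by
    intro x hx1 hx2
    have hb := (edge_bounds n D x hD hDN hx1 (by linarith)).1
    have hmp := mm_pos (n+1) D x (hX x hx2)
    have hmd := hmD x hx2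
    rw [abs_div, abs_negone_mul, abs_of_pos (a := 2 * mm (n+1) D x ^ 4) (by positivity),
      div_le_iff₀ (by positivity)]
    have : D^3 ≤ mm (n+1) D x ^ 3 := pow_le_pow_left₀ hD0.le hmd 3
    nlinarith
  have key := abs_sub_of_deriv (f := fun x => FF n x - (-1)^n * pp n x / (2 * mm (n+1) D x ^ 4))
    (f' := fun x => - ((-1)^n * (vv n x * D^4 / (2 * x * mm (n+1) D x ^ 4)
      + pp n x / (8 * mm (n+1) D x ^ 8))))
    (g := fun x => 5600 * (D / mm (n+1) D x)) (g' := fun x => 5600 * (D / (16 * mm (n+1) D x ^ 5)))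
    h1 ?_ ?_ ?_ ?_ ?_
  · have h0 := FF_step1 n (n+1) (by linarith) le_rfl
    have e1 := hpX t h1 le_rfl
    have e2 := hpX (n+1) le_rfl h1
    have e3 : D / mm (n+1) D t ≤ 1 := by
      rw [div_le_one (mm_pos _ _ _ (hX t le_rfl))]; exact hmD t le_rfl
    have e4 : 0 ≤ D / mm (n+1) D (n+1) := by
      have := mm_pos _ _ _ (hX (n+1) h1); positivity
    rw [abs_le] at *
    constructor <;> linarith [key.1, key.2, h0.1, h0.2, e1.1, e1.2, e2.1, e2.2]
  · intro x hx
    have hmp := mm_pos (n+1) D x (hX x hx.2)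
    refine ((FF_cont n).continuousAt.sub (ContinuousAt.div ?_ ?_ ?_)).continuousWithinAt
    · exact (continuous_const.mul (pp_cont n)).continuousAt
    · exact ((mm_hasDeriv (n+1) D x (hX x hx.2)).continuousAt.pow 4).const_mul 2
    · positivity
  · intro x hx
    have hmp := mm_pos (n+1) D x (hX x hx.2)
    exact (((continuousAt_const).div (mm_hasDeriv (n+1) D x (hX x hx.2)).continuousAt
      hmp.ne').const_mul 5600).continuousWithinAt
  · intro x hx
    have hx0 : 0 < x := by linarith [hx.1]
    have hmp := mm_pos (n+1) D x (hX x hx.2.le)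
    have hm4 := mm_pow (n+1) D x (hX x hx.2.le).le
    have hm := mm_hasDeriv (n+1) D x (hX x hx.2.le)
    refine ((FF_hasDeriv n x hx0).sub ((((pp_hasDeriv n x hx0).const_mul ((-1)^n)).div
      ((hm.pow 4).const_mul 2) (mul_ne_zero (by norm_num) (pow_ne_zero 4 hmp.ne'))))).congr_deriv ?_
    have hq : (n : ℝ) + 1 - x/4 = mm (n+1) D x ^ 4 - D^4 := by rw [hm4]; ring
    simp only [Pi.pow_apply]
    rw [hq]
    generalize mm (n+1) D x = m at *
    norm_num
    field_simp
    ring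
  · intro x hx
    have hmp := mm_pos (n+1) D x (hX x hx.2.le)
    have hm := mm_hasDeriv (n+1) D x (hX x hx.2.le)
    refine (((hasDerivAt_const x D).div hm hmp.ne').const_mul 5600).congr_deriv ?_
    field_simp
    ring
  · intro x hx
    have hx0 : 0 < x := by linarith [hx.1]
    have hmp := mm_pos (n+1) D x (hX x hx.2.le)
    have hmd := hmD x hx.2.le
    obtain ⟨hp, hv⟩ := edge_bounds n D x hD hDN hx.1.le (by linarith [hx.2])
    rw [abs_neg, abs_negone_mul]
    have hxD : D^12 ≤ x := by rw [hDN]; exact hx.1.le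
    generalize mm (n+1) D x = m at *
    have a1 : |vv n x * D^4 / (2 * x * m^4)| ≤ 250 * (D / m^5) := by
      rw [abs_div, abs_mul, abs_of_pos hD4, abs_of_pos (a := 2 * x * m^4) (by positivity)]
      calc |vv n x| * D^4 / (2 * x * m^4) ≤ (500 * D^9 / m) * D^4 / (2 * D^12 * m^4) := by gcongr
        _ = 250 * (D / m^5) := by field_simp; norm_num
    have a2 : |pp n x / (8 * m^8)| ≤ 30/8 * (D / m^5) := by
      rw [abs_div, abs_of_pos (a := 8 * m^8) (by positivity)]
      calc |pp n x| / (8 * m^8) ≤ (30 * D^3 * m) / (8 * m^8) := by gcongr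
        _ = 30/8 * (D / m^5) * (D/m)^2 := by field_simp
        _ ≤ 30/8 * (D / m^5) * 1 := by
          gcongr
          apply pow_le_one₀ (by positivity)
          rw [div_le_one hmp]; exact hmd
        _ = _ := by ring
    have a3 : 5600 * (D / (16 * m^5)) = 350 * (D / m^5) := by field_simp; norm_num
    have a4 : 0 ≤ D / m^5 := by positivity
    rw [a3]
    refine (abs_add_le _ _).trans ?_
    linarith

end

section
open Filter Topology

lemma pow_psi_tendsto (n : ℕ) : ∀ k : ℕ, Tendsto (fun t => t^k * psi n t) atTop (𝓝 0) := by
  have base : ∀ k : ℕ, Tendsto (fun t : ℝ => t^k * Real.exp (-t/2)) atTop (𝓝 0) := by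
    intro k
    have h := (Real.tendsto_pow_mul_exp_neg_atTop_nhds_zero k).comp
      (tendsto_id.atTop_div_const (by norm_num : (0:ℝ) < 2))
    have h2 := h.const_mul ((2:ℝ)^k)
    rw [mul_zero] at h2
    refine h2.congr (fun t => ?_)
    simp only [Function.comp, id, div_pow]
    rw [neg_div]; field_simp
  have key : ∀ n, (∀ k : ℕ, Tendsto (fun t => t^k * psi n t) atTop (𝓝 0)) ∧
      (∀ k : ℕ, Tendsto (fun t => t^k * psi (n+1) t) atTop (𝓝 0)) := by
    intro n
    induction n with
    | zero =>
      constructor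
      · intro k; simpa [psi, lag] using base k
      · intro k
        have := (base k).sub (base (k+1))
        rw [sub_zero] at this
        refine this.congr (fun t => ?_)
        simp only [psi, lag]; ring
    | succ j ih =>
      refine ⟨ih.2, fun k => ?_⟩
      have h := ((((ih.2 k).const_mul (2 * j + 3 : ℝ)).sub (ih.2 (k+1))).sub
        ((ih.1 k).const_mul (j+1 : ℝ))).div_const (j+2 : ℝ)
      simp only [mul_zero, sub_zero, zero_div] at h
      refine h.congr (fun t => ?_)
      have h2 : (j + 2 : ℝ) ≠ 0 := by positivity
      simp only [psi, lag]
      field_simp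
      ring
  exact (key n).1

lemma psi_tendsto (n : ℕ) : Tendsto (psi n) atTop (𝓝 0) := by
  simpa using pow_psi_tendsto n 0

lemma FF_tendsto (n : ℕ) : Tendsto (FF n) atTop (𝓝 0) := by
  have := tendsto_finsetSum (Finset.range (n+1))
    (fun k _ => (psi_tendsto k).const_mul ((-1:ℝ)^k))
  show Tendsto (fun t => ∑ k ∈ Finset.range (n+1), (-1)^k * psi k t) atTop (𝓝 0)
  simpa using this

lemma mono_Ici {f f' : ℝ → ℝ} {a : ℝ} (h : ∀ x ∈ Set.Ici a, HasDerivAt f (f' x) x)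
    (hn : ∀ x ∈ Set.Ici a, 0 ≤ f' x) : MonotoneOn f (Set.Ici a) := by
  apply monotoneOn_of_deriv_nonneg (convex_Ici a)
  · intro x hx; exact (h x hx).continuousAt.continuousWithinAt
  · intro x hx; exact (h x (interior_subset hx)).differentiableAt.differentiableWithinAt
  · intro x hx; rw [(h x (interior_subset hx)).deriv]; exact hn x (interior_subset hx)

lemma le_zero_of_mono {f : ℝ → ℝ} {a x : ℝ} (h : MonotoneOn f (Set.Ici a)) (hx : a ≤ x)
    (hl : Tendsto f atTop (𝓝 0)) : f x ≤ 0 := by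
  apply ge_of_tendsto hl
  filter_upwards [eventually_ge_atTop x] with y hy
  exact h hx (hx.trans hy) hy

lemma vv_sq_anti (n : ℕ) {x y : ℝ} (hx : 4 * (n+1 : ℝ) ≤ x) (hxy : x ≤ y) :
    vv n y ^ 2 ≤ vv n x ^ 2 := by
  have hn0 : (0:ℝ) ≤ n := Nat.cast_nonneg n
  have hvp : ∀ t, 4 * (n+1 : ℝ) ≤ t → vv n t * pp n t ≤ 0 := by
    intro t ht
    refine le_zero_of_mono (f := fun t => vv n t * pp n t) (a := 4 * (n+1 : ℝ))
      (mono_Ici (f' := fun t => pp n t * pp n t + vv n t * (-((n + 1 - t/4) * vv n t / t))) ?_ ?_) ht ?_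
    · intro s hs
      exact (vv_hasDeriv n s).mul (pp_hasDeriv n s (by linarith [Set.mem_Ici.1 hs]))
    · intro s hs
      have hs' := Set.mem_Ici.1 hs
      have : vv n s * (-((n + 1 - s/4) * vv n s / s)) = (s/4 - (n+1)) * (vv n s)^2 / s := by ring
      rw [this]
      have h1 : 0 ≤ (s/4 - (n+1)) * (vv n s)^2 / s :=
        div_nonneg (mul_nonneg (by linarith) (sq_nonneg _)) (by linarith)
      nlinarith [mul_self_nonneg (pp n s)]
    · have hv : Tendsto (vv n) atTop (𝓝 0) := by
        show Tendsto (fun t => (n+1 : ℝ) * (psi n t - psi (n+1) t)) atTop (𝓝 0)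
        simpa using ((psi_tendsto n).sub (psi_tendsto (n+1))).const_mul (n+1 : ℝ)
      have hp : Tendsto (pp n) atTop (𝓝 0) := by
        show Tendsto (fun t => (n+1 : ℝ) * (psi n t + psi (n+1) t) / 2) atTop (𝓝 0)
        simpa using (((psi_tendsto n).add (psi_tendsto (n+1))).const_mul (n+1 : ℝ)).div_const 2
      simpa using hv.mul hp
  refine anti_of_deriv (f := fun t => vv n t ^ 2) (f' := fun t => 2 * (vv n t * pp n t)) hxy ?_ ?_
  · intro s _
    refine ((vv_hasDeriv n s).pow 2).congr_deriv ?_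
    norm_num; ring
  · intro s hs
    have := hvp s (hx.trans hs.1)
    linarith

lemma vv_cont (n : ℕ) : Continuous (vv n) :=
  continuous_iff_continuousAt.2 (fun t => (vv_hasDeriv n t).continuousAt)

lemma vv_sign (n : ℕ) (s : ℝ) (hs : s = 1 ∨ s = -1) (h : 0 ≤ s * vv n (4 * (n+1))) (x : ℝ)
    (hx : 4 * (n+1 : ℝ) ≤ x) : 0 ≤ s * vv n x := by
  by_contra hneg
  push Not at hneg
  have hc : ContinuousOn (fun t => s * vv n t) (Set.Icc (4 * (n+1 : ℝ)) x) :=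
    (continuous_const.mul (vv_cont n)).continuousOn
  obtain ⟨y, hy, hy0⟩ := intermediate_value_Icc' hx hc ⟨hneg.le, h⟩
  have hvy : vv n y = 0 := by
    rcases hs with rfl | rfl <;> simpa using hy0
  have := vv_sq_anti n hy.1 hy.2
  rw [hvy] at this
  have hvx : vv n x = 0 := by
    have : vv n x ^ 2 = 0 := le_antisymm (by simpa using this) (sq_nonneg _)
    exact pow_eq_zero_iff (by norm_num) |>.1 this
  rw [hvx] at hneg; simp at hneg

lemma FF_step3 (n : ℕ) (t : ℝ) (ht : 4 * (n+1 : ℝ) ≤ t) : |FF n t| ≤ 6000 := by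
  have hn0 : (0:ℝ) ≤ n := Nat.cast_nonneg n
  have h4 := FF_step2 n (4 * (n+1)) (by linarith) le_rfl
  obtain ⟨s, hs, hsv⟩ : ∃ s : ℝ, (s = 1 ∨ s = -1) ∧ 0 ≤ s * vv n (4 * (n+1)) := by
    rcases le_total 0 (vv n (4 * (n+1))) with h | h
    · exact ⟨1, Or.inl rfl, by linarith⟩
    · exact ⟨-1, Or.inr rfl, by linarith⟩
  have hsign := vv_sign n s hs hsv
  -- monotone function -(−1)^n s F
  have hmono : MonotoneOn (fun x => -((-1)^n * s) * FF n x) (Set.Ici (4 * (n+1 : ℝ))) := by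
    refine mono_Ici (f' := fun x => -((-1)^n * s) * (-((-1)^n * vv n x / (2 * x)))) ?_ ?_
    · intro x hx
      exact (FF_hasDeriv n x (by linarith [Set.mem_Ici.1 hx])).const_mul _
    · intro x hx
      have hx' := Set.mem_Ici.1 hx
      have e : -((-1)^n * s) * (-((-1)^n * vv n x / (2 * x))) = (((-1)^n)^2) * (s * vv n x) / (2 * x) := by
        ring
      rw [e]
      have := hsign x hx
      apply div_nonneg (mul_nonneg (sq_nonneg _) this) (by linarith)
  have hle := le_zero_of_mono hmono ht (by simpa using (FF_tendsto n).const_mul (-((-1)^n * s)))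
  have hge := hmono (Set.mem_Ici.2 le_rfl) ht ht
  simp only at hge
  have habs : ∀ y, |-((-1)^n * s) * y| = |y| := by
    intro y
    rw [abs_mul, abs_neg, abs_negone_mul]
    rcases hs with rfl | rfl <;> simp
  rw [← habs] at h4 ⊢
  rw [abs_of_nonpos hle]
  rw [abs_of_nonpos (hge.trans hle)] at h4
  linarith

lemma FF_bound (n : ℕ) (t : ℝ) (ht : 0 ≤ t) : |FF n t| ≤ 6000 := by
  rcases le_total t (n+1) with h | h
  · exact (FF_step1 n t ht h).trans (by norm_num)
  · rcases le_total t (4 * (n+1)) with h' | h'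
    · exact FF_step2 n t h h'
    · exact FF_step3 n t h'

end

section
noncomputable def gg (n : ℕ) (x : ℝ) : ℝ := iteratedDeriv n (fun t : ℝ => Real.exp (-t ^ 2)) x

lemma gg_hasDeriv (n : ℕ) (x : ℝ) : HasDerivAt (gg n) (gg (n+1) x) x := by
  have hc : ContDiff ℝ ⊤ (fun t : ℝ => Real.exp (-t ^ 2)) := by fun_prop
  have h := hc.differentiable_iteratedDeriv n (by exact_mod_cast WithTop.coe_lt_top _)
  have := (h x).hasDerivAt
  rw [← iteratedDeriv_succ] at this
  exact this

lemma gg_zero (x : ℝ) : gg 0 x = Real.exp (-x^2) := by simp [gg]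

lemma gg_one (x : ℝ) : gg 1 x = -2 * x * gg 0 x := by
  have h : HasDerivAt (gg 0) (Real.exp (-x^2) * (-(2 * x))) x := by
    have h1 : HasDerivAt (fun t : ℝ => -t^2) (-(2 * x)) x := by
      refine (((hasDerivAt_id x).pow 2).neg).congr_deriv ?_; simp
    have : gg 0 = fun t : ℝ => Real.exp (-t^2) := by ext t; exact gg_zero t
    rw [this]; exact h1.exp
  rw [(gg_hasDeriv 0 x).unique h, gg_zero]; ring

lemma gg_rec (n : ℕ) (x : ℝ) : gg (n+2) x = -2 * x * gg (n+1) x - 2 * (n+1) * gg n x := by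
  have h0 : ∀ y, HasDerivAt (fun x : ℝ => -2 * x) (-2) y := fun y => by
    simpa using (hasDerivAt_id y).const_mul (-2)
  induction n generalizing x with
  | zero =>
    have h : HasDerivAt (gg 1) (-2 * gg 0 x + -2 * x * gg 1 x) x := by
      have : gg 1 = fun t : ℝ => -2 * t * gg 0 t := by ext t; exact gg_one t
      have h2 := (h0 x).mul (gg_hasDeriv 0 x)
      rw [this]; simp only [zero_add] at h2; rw [this] at h2; exact h2
    have := (gg_hasDeriv 1 x).unique h
    simp only [Nat.cast_zero, zero_add] at *
    rw [this]; ring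
  | succ k ih =>
    have h : HasDerivAt (gg (k+2)) ((-2 * gg (k+1) x + -2 * x * gg (k+2) x)
        - 2 * (k+1) * gg (k+1) x) x := by
      have : gg (k+2) = fun t : ℝ => -2 * t * gg (k+1) t - 2 * (k+1) * gg k t := by ext t; exact ih t
      have h2 := ((h0 x).mul (gg_hasDeriv (k+1) x)).sub ((gg_hasDeriv k x).const_mul (2 * (k+1) : ℝ))
      have e : (fun t : ℝ => -2 * t * gg (k+1) t - 2 * (k+1) * gg k t) =
        (fun x => -2 * x) * gg (k + 1) - fun y => 2 * (↑k + 1) * gg k y := rfl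
      rw [e] at this; nth_rewrite 1 [this]; exact h2
    have := (gg_hasDeriv (k+2) x).unique h
    rw [show k + 1 + 2 = k + 2 + 1 by ring, this]; push_cast; ring

lemma hermitePoly_eq (n : ℕ) (x : ℝ) : hermitePoly n x = (-1)^n * Real.exp (x^2) * gg n x := rfl

lemma hermitePoly_zero (x : ℝ) : hermitePoly 0 x = 1 := by
  rw [hermitePoly_eq, gg_zero]; simp [← Real.exp_add]

lemma hermitePoly_one (x : ℝ) : hermitePoly 1 x = 2 * x := by
  have h := hermitePoly_zero x
  rw [hermitePoly_eq] at *
  rw [gg_one]; linear_combination 2 * x * h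

lemma hermitePoly_rec (n : ℕ) (x : ℝ) :
    hermitePoly (n+2) x = 2 * x * hermitePoly (n+1) x - 2 * (n+1) * hermitePoly n x := by
  simp only [hermitePoly_eq, gg_rec]; ring

/-- H_{n+1} = 2x H_n - H_n' -/
lemma hermitePoly_hasDeriv' (n : ℕ) (x : ℝ) :
    HasDerivAt (hermitePoly n) (2 * x * hermitePoly n x - hermitePoly (n+1) x) x := by
  have h1 : HasDerivAt (fun t : ℝ => t^2) (2 * x) x := by
    refine ((hasDerivAt_id x).pow 2).congr_deriv ?_; simp
  have h := (h1.exp.const_mul ((-1:ℝ)^n)).mul (gg_hasDeriv n x)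
  refine HasDerivAt.congr_deriv (f := hermitePoly n) h ?_
  simp only [hermitePoly_eq]; ring

noncomputable def nrm (n : ℕ) : ℝ := Real.sqrt ((n.factorial : ℝ) * 2 ^ n * Real.sqrt Real.pi)

lemma nrm_pos (n : ℕ) : 0 < nrm n := by unfold nrm; positivity

lemma nrm_succ (n : ℕ) : nrm (n+1) = Real.sqrt (2 * (n+1)) * nrm n := by
  unfold nrm
  rw [← Real.sqrt_mul (by positivity)]
  congr 1
  rw [Nat.factorial_succ]; push_cast; ring

lemma hermiteFun_eq (n : ℕ) (x : ℝ) :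
    hermiteFun n x = hermitePoly n x * Real.exp (-x ^ 2 / 2) / nrm n := rfl

/-- h' relations: h_n' = x h_n - √(2(n+1)) h_{n+1} -/
lemma hermiteFun_hasDeriv (n : ℕ) (x : ℝ) :
    HasDerivAt (hermiteFun n) (x * hermiteFun n x - Real.sqrt (2 * (n+1)) * hermiteFun (n+1) x) x := by
  have h1 : HasDerivAt (fun t : ℝ => -t^2/2) (-x) x := by
    refine (((hasDerivAt_id x).pow 2).neg.div_const 2).congr_deriv ?_
    simp; ring
  have h := ((hermitePoly_hasDeriv' n x).mul h1.exp).div_const (nrm n)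
  refine HasDerivAt.congr_deriv (f := hermiteFun n) h ?_
  simp only [hermiteFun_eq, nrm_succ]
  have := nrm_pos n
  have h2 : 0 < Real.sqrt (2 * (n+1)) := by positivity
  field_simp
  ring

lemma hermiteFun_rec (n : ℕ) (x : ℝ) :
    Real.sqrt (2 * (n+2)) * hermiteFun (n+2) x
      = 2 * x * hermiteFun (n+1) x - Real.sqrt (2 * (n+1)) * hermiteFun n x := by
  simp only [hermiteFun_eq, hermitePoly_rec, nrm_succ]
  have := nrm_pos n
  have h2 : 0 < Real.sqrt (2 * (n+1)) := by positivity
  have h3 : 0 < Real.sqrt (2 * (n+2)) := by positivity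
  have h4 : Real.sqrt (2 * (n+1)) ^ 2 = 2 * (n+1) := Real.sq_sqrt (by positivity)
  rw [show (((n+1 : ℕ) : ℝ) + 1) = n + 2 by push_cast; ring]
  field_simp
  rw [h4]; ring

lemma hermiteFun_rec1 (x : ℝ) :
    Real.sqrt 2 * hermiteFun 1 x = 2 * x * hermiteFun 0 x := by
  simp only [hermiteFun_eq, hermitePoly_one, hermitePoly_zero]
  rw [nrm_succ 0]
  have := nrm_pos 0
  simp
  field_simp

lemma hermiteFun_zero_sq (x : ℝ) : hermiteFun 0 x ^ 2 = Real.exp (-x^2) / Real.sqrt Real.pi := by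
  rw [hermiteFun_eq, hermitePoly_zero, nrm, div_pow, Real.sq_sqrt (by positivity)]
  rw [one_mul, ← Real.exp_nat_mul]
  simp
  congr 1; ring

/-- square recurrence -/
lemma hsq_rec (k : ℕ) (x : ℝ) :
    (k+3) * hermiteFun (k+3) x ^ 2 + (k+2) * hermiteFun (k+2) x ^ 2
      - (k+2) * hermiteFun (k+1) x ^ 2 - (k+1) * hermiteFun k x ^ 2
     = 2 * x^2 * (hermiteFun (k+2) x ^ 2 - hermiteFun (k+1) x ^ 2) := by
  have h1 := hermiteFun_rec k x
  have h2 := hermiteFun_rec (k+1) x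
  push_cast at h2
  have s1 : Real.sqrt (2 * (k+1)) ^ 2 = 2 * (k+1) := Real.sq_sqrt (by positivity)
  have s2 : Real.sqrt (2 * (k+2)) ^ 2 = 2 * (k+2) := Real.sq_sqrt (by positivity)
  have s3 : Real.sqrt (2 * (k+3)) ^ 2 = 2 * (k+3) := Real.sq_sqrt (by positivity)
  rw [show (k + 1 + 2 : ℝ) = k + 3 by ring, show (k + 1 + 1 : ℝ) = k + 2 by ring] at h2
  rw [show k + 1 + 2 = k + 3 by ring, show k + 1 + 1 = k + 2 by ring] at h2
  generalize Real.sqrt (2 * (k+1)) = a at *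
  generalize Real.sqrt (2 * (k+2)) = b at *
  generalize Real.sqrt (2 * (k+3)) = c at *
  generalize hermiteFun k x = u0 at *
  generalize hermiteFun (k+1) x = u1 at *
  generalize hermiteFun (k+2) x = u2 at *
  generalize hermiteFun (k+3) x = u3 at *
  have e1 : (c * u3)^2 = (2 * x * u2 - b * u1)^2 := by rw [h2]
  have e2 : (a * u0)^2 = (2 * x * u1 - b * u2)^2 := by rw [show a * u0 = 2 * x * u1 - b * u2 by linarith]
  linear_combination (1/2) * e1 - (1/2) * e2 - (1/2) * u3^2 * s3 + (1/2) * u0^2 * s1 + (1/2) * (u1^2 - u2^2) * s2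

lemma hsq_rec1 (x : ℝ) : hermiteFun 1 x ^ 2 = 2 * x^2 * hermiteFun 0 x ^ 2 := by
  have h := hermiteFun_rec1 x
  have s : Real.sqrt 2 ^ 2 = 2 := Real.sq_sqrt (by norm_num)
  have e : (Real.sqrt 2 * hermiteFun 1 x)^2 = (2 * x * hermiteFun 0 x)^2 := by rw [h]
  linear_combination (1/2) * e - (1/2) * hermiteFun 1 x ^ 2 * s

lemma hsq_rec2 (x : ℝ) : 2 * hermiteFun 2 x ^ 2 + hermiteFun 1 x ^ 2 - hermiteFun 0 x ^ 2
     = 2 * x^2 * (hermiteFun 1 x ^ 2 - hermiteFun 0 x ^ 2) := by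
  have h1 := hermiteFun_rec1 x
  have h2 := hermiteFun_rec 0 x
  simp only [Nat.cast_zero, zero_add, mul_one] at h2
  have s : Real.sqrt 2 ^ 2 = 2 := Real.sq_sqrt (by norm_num)
  have s2 : Real.sqrt (2 * 2) ^ 2 = 4 := by rw [Real.sq_sqrt (by norm_num)]; norm_num
  generalize Real.sqrt (2*2) = b at *
  generalize Real.sqrt 2 = a at *
  generalize hermiteFun 0 x = u0 at *
  generalize hermiteFun 1 x = u1 at *
  generalize hermiteFun 2 x = u2 at *
  have e1 : (b * u2)^2 = (2 * x * u1 - a * u0)^2 := by rw [h2]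
  have e2 : (2 * x * u0 - a * u1)^2 = 0 := by rw [← h1]; ring
  linear_combination (1/2) * e1 + (1/2) * e2 - (1/2) * u2^2 * s2 + (1/2) * (u0^2 - u1^2) * s

end

section
noncomputable def MM (x : ℝ) : PowerSeries ℝ := PowerSeries.mk (fun k => hermiteFun k x ^ 2)

open PowerSeries in
lemma MM_ode (x : ℝ) : (1 - X) * (1 + X)^2 * d⁄dX ℝ (MM x)
    = (X * (1 + X) + C (2 * x^2) * (1 - X)) * MM x := by
  have e1 : (1 - X) * (1 + X)^2 * d⁄dX ℝ (MM x) =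
    d⁄dX ℝ (MM x) + X * (d⁄dX ℝ (MM x) - X * (d⁄dX ℝ (MM x) + X * d⁄dX ℝ (MM x))) := by ring
  have e2 : (X * (1 + X) + C (2 * x^2) * (1 - X)) * MM x =
    C (2 * x^2) * MM x + X * (MM x - C (2 * x^2) * MM x + X * MM x) := by ring
  rw [e1, e2]
  ext n
  match n with
  | 0 =>
    have := hsq_rec1 x
    simp only [map_add, coeff_zero_X_mul, coeff_C_mul, coeff_derivative, MM, coeff_mk]
    push_cast
    linarith
  | 0+1 =>
    have := hsq_rec2 x
    simp only [map_add, map_sub, coeff_succ_X_mul, coeff_zero_X_mul, coeff_C_mul, coeff_derivative, MM, coeff_mk]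
    push_cast
    norm_num at this ⊢
    linarith
  | k+2 =>
    have := hsq_rec k x
    simp only [map_add, map_sub, PowerSeries.coeff_succ_X_mul, PowerSeries.coeff_C_mul, MM,
      PowerSeries.coeff_derivative, PowerSeries.coeff_mk, show k + 2 = (k+1) + 1 from rfl]
    match k with
    | 0 =>
      simp only [coeff_zero_X_mul]
      norm_num at this ⊢; linarith
    | j+1 =>
      simp only [PowerSeries.coeff_succ_X_mul, PowerSeries.coeff_derivative, PowerSeries.coeff_mk]
      push_cast at this ⊢
      linarith

noncomputable def phis (x y : ℝ) : PowerSeries ℝ := (1 - PowerSeries.X) * (MM x * MM y)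

open PowerSeries in
lemma phis_ode (x y : ℝ) : (1 + X)^2 * d⁄dX ℝ (phis x y)
    = (C (2 * (x^2+y^2) - 1) - X) * phis x y := by
  have h1 := MM_ode x
  have h2 := MM_ode y
  have hd : d⁄dX ℝ (phis x y) = - (MM x * MM y) + (1 - X) * (d⁄dX ℝ (MM x) * MM y + MM x * d⁄dX ℝ (MM y)) := by
    unfold phis
    rw [Derivation.leibniz, Derivation.leibniz, map_sub, PowerSeries.derivative_X]
    simp
    ring
  have c1 : (C (2 * (x^2+y^2) - 1) : PowerSeries ℝ) = C (2 * x^2) + C (2 * y^2) - 1 := by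
    rw [← map_one C, ← map_add, ← map_sub]; congr 1; ring
  rw [hd, c1]; unfold phis
  linear_combination MM y * h1 + MM x * h2

open PowerSeries in
lemma phis_coeff (x y : ℝ) (k : ℕ) :
    coeff k (phis x y) = (-1)^k * psi k (2 * (x^2+y^2)) / Real.pi := by
  have h := phis_ode x y
  have e1 : (1 + X)^2 * d⁄dX ℝ (phis x y) = d⁄dX ℝ (phis x y) + X * (d⁄dX ℝ (phis x y) + d⁄dX ℝ (phis x y)
     + X * d⁄dX ℝ (phis x y)) := by ring
  have e2 : (C (2 * (x^2+y^2) - 1) - X) * phis x y = C (2 * (x^2+y^2) - 1) * phis x y - X * phis x y := by ring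
  rw [e1, e2] at h
  generalize hA : 2 * (x^2+y^2) - 1 = A at h
  have hA2 : 2 * (x^2+y^2) = A + 1 := by linarith
  have z : coeff 0 (phis x y) = psi 0 (2 * (x^2+y^2)) / Real.pi := by
    have hs : Real.sqrt Real.pi * Real.sqrt Real.pi = Real.pi := Real.mul_self_sqrt Real.pi_pos.le
    simp only [phis, MM, sub_mul, one_mul, map_sub, coeff_zero_X_mul, sub_zero]
    simp only [coeff_zero_eq_constantCoeff, map_mul]
    simp only [← coeff_zero_eq_constantCoeff, coeff_mk, hermiteFun_zero_sq, psi, lag]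
    rw [div_mul_div_comm, hs, ← Real.exp_add, mul_one]
    congr 2; ring
  have h0 := congrArg (coeff 0) h
  simp only [map_add, map_sub, coeff_zero_X_mul, coeff_C_mul, coeff_derivative] at h0
  induction k using Nat.strong_induction_on with
  | _ k ih =>
    match k, ih with
    | 0, _ => rw [z]; simp
    | 1, ih =>
      rw [z, hA2] at h0
      rw [hA2]
      simp only [psi, lag] at h0 ⊢
      norm_num at h0 ⊢
      rw [h0]; ring
    | k+2, ih =>
      have ih1 := ih (k+1) (by omega)
      have ih0 := ih k (by omega)
      have hh := congrArg (coeff (k+1)) h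
      simp only [map_add, map_sub, coeff_succ_X_mul, coeff_C_mul, coeff_derivative] at hh
      have hp : (k+2) * psi (k+2) (2 * (x^2+y^2)) = (2*k+3 - 2 * (x^2+y^2)) * psi (k+1) (2 * (x^2+y^2)) - (k+1) * psi k (2 * (x^2+y^2)) := by
        have := lag_rec k (2 * (x^2+y^2))
        simp only [psi]
        linear_combination Real.exp (-(2 * (x^2+y^2))/2) * this
      have hk : (k + 2 : ℝ) ≠ 0 := by positivity
      apply mul_left_cancel₀ hk
      have e : (k+2:ℝ) * ((-1) ^ (k + 2) * psi (k + 2) (2 * (x ^ 2 + y ^ 2)) / Real.pi)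
        = (-1)^k / Real.pi * ((k+2) * psi (k + 2) (2 * (x ^ 2 + y ^ 2))) := by ring
      rw [e, hp]
      match k with
      | 0 =>
        simp only [coeff_zero_X_mul] at hh
        rw [ih1, ih0] at hh
        rw [hA2] at hh ⊢
        norm_num at hh ⊢
        linear_combination hh
      | j+1 =>
        simp only [coeff_succ_X_mul, coeff_derivative] at hh
        rw [ih1, ih0] at hh
        rw [hA2] at hh ⊢
        push_cast at hh ⊢
        simp only [pow_succ] at hh ⊢
        linear_combination hh

open PowerSeries in
lemma MM_mul_coeff (x y : ℝ) (n : ℕ) :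
    coeff n (MM x * MM y) = FF n (2 * (x^2+y^2)) / Real.pi := by
  induction n with
  | zero =>
    have := phis_coeff x y 0
    simp only [phis, sub_mul, one_mul, map_sub, coeff_zero_X_mul, sub_zero] at this
    rw [this]; simp [FF]
  | succ n ih =>
    have := phis_coeff x y (n+1)
    simp only [phis, sub_mul, one_mul, map_sub, coeff_succ_X_mul] at this
    rw [ih] at this
    rw [FF, Finset.sum_range_succ, ← FF]
    linear_combination this

lemma e2_bound (x y : ℝ) (n : ℕ) :
    ∑ k ∈ Finset.HasAntidiagonal.antidiagonal n, hermiteFun k.1 x ^ 2 * hermiteFun k.2 y ^ 2 ≤ 6000 := by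
  have h := MM_mul_coeff x y n
  rw [PowerSeries.coeff_mul] at h
  simp only [MM, PowerSeries.coeff_mk] at h
  rw [h]
  have h2 := FF_bound n (2 * (x^2+y^2)) (by positivity)
  rw [div_le_iff₀ Real.pi_pos]
  have := Real.pi_gt_three
  have := (abs_le.1 h2).2
  linarith

end

section
lemma b_rec (j : ℕ) : (j+2 : ℝ) * hermiteFun (j+2) 0 ^ 2 = (j+1) * hermiteFun j 0 ^ 2 := by
  have h := hermiteFun_rec j 0
  have s1 : Real.sqrt (2 * (j+1)) ^ 2 = 2 * (j+1) := Real.sq_sqrt (by positivity)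
  have s2 : Real.sqrt (2 * (j+2)) ^ 2 = 2 * (j+2) := Real.sq_sqrt (by positivity)
  have e : (Real.sqrt (2 * (j+2)) * hermiteFun (j+2) 0)^2 = (Real.sqrt (2 * (j+1)) * hermiteFun j 0)^2 := by
    rw [h]; ring
  rw [mul_pow, mul_pow, s1, s2] at e
  linarith

lemma b_lower (m : ℕ) : 1 / (Real.pi * (4 * m + 1)) ≤ (hermiteFun (2*m) 0 ^ 2) ^ 2 := by
  induction m with
  | zero =>
    have h := hermiteFun_zero_sq 0
    rw [mul_zero, h, div_pow, Real.sq_sqrt Real.pi_pos.le]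
    simp
  | succ m ih =>
    have h := b_rec (2 * m)
    push_cast at h
    rw [show 2 * (m+1) = 2 * m + 2 by ring]
    generalize hermiteFun (2 * m + 2) 0 ^ 2 = v at *
    generalize hermiteFun (2 * m) 0 ^ 2 = u at *
    have hv : v = (2 * m + 1) / (2 * m + 2) * u := by field_simp; linarith
    rw [hv, mul_pow]
    refine le_trans ?_ (mul_le_mul_of_nonneg_left ih (by positivity))
    push_cast
    have hm : (0:ℝ) ≤ m := by positivity
    rw [div_pow, div_mul_div_comm, div_le_div_iff₀ (by positivity) (by positivity)]
    have : (2 * m + 2:ℝ)^2 * (4 * m + 1) ≤ (2 * m + 1)^2 * (4 * (m+1) + 1) := by nlinarith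
    nlinarith [Real.pi_pos, mul_le_mul_of_nonneg_left this Real.pi_pos.le]

lemma b_low2 (n l : ℕ) (hl : l ≤ n) :
    1 / (4 * Real.sqrt (n+1)) ≤ hermiteFun l 0 ^ 2 + hermiteFun (l+1) 0 ^ 2 := by
  have key : ∀ m : ℕ, 2 * m ≤ n + 1 → 1 / (4 * Real.sqrt (n+1)) ≤ hermiteFun (2*m) 0 ^ 2 := by
    intro m hm
    have h := b_lower m
    apply le_of_sq_le_sq _ (by positivity)
    refine le_trans ?_ h
    rw [div_pow, mul_pow, Real.sq_sqrt (by positivity)]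
    have hm' : (2 * m : ℝ) ≤ n + 1 := by exact_mod_cast hm
    have := Real.pi_lt_four
    have := Real.pi_pos
    rw [one_pow]
    apply one_div_le_one_div_of_le (by positivity)
    nlinarith
  rcases Nat.even_or_odd' l with ⟨m, h | h⟩
  · have := key m (by omega)
    rw [h]; linarith [sq_nonneg (hermiteFun (2*m+1) 0)]
  · have := key (m+1) (by omega)
    rw [h, show 2 * m + 1 + 1 = 2 * (m+1) by ring]; linarith [sq_nonneg (hermiteFun (2*m+1) 0)]

lemma one_bound (n : ℕ) (x : ℝ) :
    ∑ k ∈ Finset.HasAntidiagonal.antidiagonal n, hermiteFun k.1 x ^ 2 ≤ 48000 * Real.sqrt (n+1) := by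
  have h1 := e2_bound x 0 n
  have h2 := e2_bound x 0 (n+1)
  rw [Finset.Nat.sum_antidiagonal_succ'] at h2
  have h3 : 0 ≤ hermiteFun (n+1) x ^ 2 * hermiteFun 0 0 ^ 2 := by positivity
  have h4 : ∑ k ∈ Finset.HasAntidiagonal.antidiagonal n, hermiteFun k.1 x ^ 2 * (1 / (4 * Real.sqrt (n+1)))
     ≤ ∑ k ∈ Finset.HasAntidiagonal.antidiagonal n, (hermiteFun k.1 x ^ 2 * hermiteFun k.2 0 ^ 2 +
        hermiteFun k.1 x ^ 2 * hermiteFun (k.2+1) 0 ^ 2) := by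
    apply Finset.sum_le_sum
    intro k hk
    rw [Finset.HasAntidiagonal.mem_antidiagonal] at hk
    rw [← mul_add]
    exact mul_le_mul_of_nonneg_left (b_low2 n k.2 (by omega)) (by positivity)
  rw [Finset.sum_add_distrib, ← Finset.sum_mul, mul_one_div] at h4
  have hs : 0 < Real.sqrt (n+1) := by positivity
  have h5 := h4.trans (by linarith : _ ≤ (12000:ℝ))
  rw [div_le_iff₀ (by positivity)] at h5
  linarith

lemma sum_aT_succ {M : Type*} [AddCommMonoid M] (k n : ℕ) (f : (Fin (k+1) → ℕ) → M) :
    ∑ i ∈ Finset.Nat.antidiagonalTuple (k+1) n, f i =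
      ∑ p ∈ Finset.HasAntidiagonal.antidiagonal n, ∑ j ∈ Finset.Nat.antidiagonalTuple k p.2, f (Fin.cons p.1 j) := by
  rw [Finset.sum_sigma']
  refine Finset.sum_bij' (fun i _ => ⟨(i 0, ∑ l, Fin.tail i l), Fin.tail i⟩) (fun q _ => Fin.cons q.1.1 q.2) ?_ ?_ ?_ ?_ ?_
  · intro i hi
    rw [Finset.Nat.mem_antidiagonalTuple, Fin.sum_univ_succ] at hi
    simp [Finset.Nat.mem_antidiagonalTuple, Fin.tail, hi]
  · rintro ⟨⟨a, b⟩, j⟩ hq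
    simp [Finset.Nat.mem_antidiagonalTuple] at hq
    simp [Finset.Nat.mem_antidiagonalTuple, Fin.sum_univ_succ, hq]
  · intro i hi; simp
  · rintro ⟨⟨a, b⟩, j⟩ hq
    simp [Finset.Nat.mem_antidiagonalTuple] at hq
    simp [Fin.tail, hq]
  · intro i hi; simp

lemma eSpec_succ (d n : ℕ) (x : Fin (d+1) → ℝ) :
    eSpec (d+1) n x = ∑ p ∈ Finset.HasAntidiagonal.antidiagonal n, hermiteFun p.1 (x 0) ^ 2 * eSpec d p.2 (Fin.tail x) := by
  unfold eSpec
  rw [sum_aT_succ]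
  refine Finset.sum_congr rfl fun p _ => ?_
  rw [Finset.mul_sum]
  refine Finset.sum_congr rfl fun j _ => ?_
  rw [Fin.prod_univ_succ]
  simp [Fin.tail]

lemma eSpec_nonneg (d n : ℕ) (x : Fin d → ℝ) : 0 ≤ eSpec d n x :=
  Finset.sum_nonneg fun _ _ => Finset.prod_nonneg fun _ _ => sq_nonneg _

lemma eSpec_one (n : ℕ) (x : Fin 1 → ℝ) : eSpec 1 n x = hermiteFun n (x 0) ^ 2 := by
  simp [eSpec]

lemma eSpec_bound (d n : ℕ) (x : Fin (d+2) → ℝ) :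
    eSpec (d+2) n x ≤ 6000 * 48000^d * Real.sqrt (n+1) ^ d := by
  induction d generalizing n with
  | zero =>
    rw [eSpec_succ]
    simp only [zero_add, eSpec_one]
    have := e2_bound (x 0) (Fin.tail x 0) n
    simpa using this
  | succ d ih =>
    rw [eSpec_succ]
    have : ∀ p ∈ Finset.HasAntidiagonal.antidiagonal n, hermiteFun p.1 (x 0) ^ 2 * eSpec (d+2) p.2 (Fin.tail x)
        ≤ hermiteFun p.1 (x 0) ^ 2 * (6000 * 48000^d * Real.sqrt (n+1) ^ d) := by
      intro p hp
      rw [Finset.HasAntidiagonal.mem_antidiagonal] at hp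
      have : (p.2 : ℝ) ≤ n := by exact_mod_cast (by omega : p.2 ≤ n)
      refine mul_le_mul_of_nonneg_left ((ih p.2 _).trans ?_) (by positivity)
      gcongr
    refine (Finset.sum_le_sum this).trans ?_
    rw [← Finset.sum_mul]
    refine (mul_le_mul_of_nonneg_right (one_bound n (x 0)) (by positivity)).trans (le_of_eq ?_)
    ring

lemma card_aT (d n : ℕ) : (Finset.Nat.antidiagonalTuple (d+1) n).card = Ddim (d+1) n := by
  induction d generalizing n with
  | zero => simp [Ddim]
  | succ d ih =>
    rw [Finset.card_eq_sum_ones, sum_aT_succ]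
    simp only [← Finset.card_eq_sum_ones, ih]
    have := Finset.sum_antidiagonal_choose_add d n
    simp only [Ddim]
    rw [show n + (d+1+1) - 1 = d + n + 1 by omega, show d + 1 + 1 - 1 = d + 1 by omega, ← this]
    refine Finset.sum_congr rfl fun p _ => ?_
    rw [show p.2 + (d+1) - 1 = d + p.2 by omega, show d + 1 - 1 = d by omega]

lemma Ddim_lower (d n : ℕ) : ((n:ℝ)+1)^(d+1) / (d+1).factorial ≤ Ddim (d+2) n := by
  have := Nat.pow_le_choose (α := ℝ) (d+1) (n+d+1)
  simp only [Ddim]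
  rw [show n + (d+2) - 1 = n + d + 1 by omega, show d + 2 - 1 = d + 1 by omega]
  rw [show n + d + 1 + 1 - (d+1) = n + 1 by omega] at this
  exact_mod_cast this

lemma Ddim_pos (d n : ℕ) : (0:ℝ) < Ddim (d+2) n :=
  lt_of_lt_of_le (by positivity) (Ddim_lower d n)

lemma g_bound (d : ℕ) (hd : 2 ≤ d) : ∃ K : ℝ, 0 < K ∧ ∀ (n : ℕ) (x : Fin d → ℝ),
    eSpec d n x / Ddim d n ≤ K * ((n:ℝ)+1) ^ (-(d:ℝ)/2) := by
  obtain ⟨d, rfl⟩ := Nat.exists_eq_add_of_le' hd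
  refine ⟨6000 * 48000^d * (d+1).factorial, by positivity, fun n x => ?_⟩
  rw [div_le_iff₀ (Ddim_pos d n)]
  refine (eSpec_bound d n x).trans ?_
  refine le_trans ?_ (mul_le_mul_of_nonneg_left (Ddim_lower d n) (by positivity))
  have hn : (0:ℝ) < n + 1 := by positivity
  have e1 : Real.sqrt (n+1) ^ d = ((n:ℝ)+1) ^ ((d:ℝ)/2) := by
    rw [Real.sqrt_eq_rpow, ← Real.rpow_natCast, ← Real.rpow_mul hn.le]; congr 1; ring
  have e2 : ((n:ℝ)+1) ^ ((d:ℝ)/2) = ((n:ℝ)+1) ^ (-((d+2:ℕ):ℝ)/2) * ((n:ℝ)+1)^(d+1) := by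
    rw [← Real.rpow_natCast, ← Real.rpow_add hn]; congr 1; push_cast; ring
  rw [e1, e2]
  have : (0:ℝ) < (d+1).factorial := by positivity
  apply le_of_eq
  field_simp

end

section
open MeasureTheory Filter Topology

lemma hermiteFun_cont (n : ℕ) : Continuous (hermiteFun n) :=
  continuous_iff_continuousAt.2 fun x => (hermiteFun_hasDeriv n x).continuousAt

lemma hermitePoly_poly (n : ℕ) : ∃ P : Polynomial ℝ, ∀ x, hermitePoly n x = P.eval x := by
  induction n using Nat.strong_induction_on with
  | _ n ih =>
    match n, ih with
    | 0, _ => exact ⟨1, fun x => by simp [hermitePoly_zero]⟩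
    | 1, _ => exact ⟨2 * Polynomial.X, fun x => by simp [hermitePoly_one]⟩
    | k+2, ih =>
      obtain ⟨P, hP⟩ := ih k (by omega)
      obtain ⟨Q, hQ⟩ := ih (k+1) (by omega)
      exact ⟨2 * Polynomial.X * Q - Polynomial.C (2 * (k+1:ℝ)) * P, fun x => by
        rw [hermitePoly_rec, hP, hQ]; simp⟩

lemma poly_gauss_int (P : Polynomial ℝ) : Integrable (fun x : ℝ => P.eval x * Real.exp (-x^2)) := by
  induction P using Polynomial.induction_on' with
  | add p q hp hq =>
    refine (hp.add hq).congr (ae_of_all _ fun x => ?_)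
    simp [add_mul]
  | monomial n a =>
    have hn : (-1:ℝ) < n := by
      have : (0:ℝ) ≤ n := by positivity
      linarith
    have := (integrable_rpow_mul_exp_neg_mul_sq (b := 1) one_pos (s := (n:ℝ)) hn).const_mul a
    refine this.congr (ae_of_all _ fun x => ?_)
    simp [mul_assoc]

lemma hmul_int (n m : ℕ) : Integrable (fun x : ℝ => hermiteFun n x * hermiteFun m x) := by
  obtain ⟨P, hP⟩ := hermitePoly_poly n
  obtain ⟨Q, hQ⟩ := hermitePoly_poly m
  have := (poly_gauss_int (P * Q)).const_mul (1 / (nrm n * nrm m))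
  refine this.congr (ae_of_all _ fun x => ?_)
  have hn := nrm_pos n
  have hm := nrm_pos m
  simp only [hermiteFun_eq, hP, hQ, Polynomial.eval_mul]
  have e : Real.exp (-x^2) = Real.exp (-x^2/2) * Real.exp (-x^2/2) := by
    rw [← Real.exp_add]; congr 1; ring
  rw [e]
  field_simp

lemma hsq_int (n : ℕ) : Integrable (fun x : ℝ => hermiteFun n x ^ 2) := by
  simpa [sq] using hmul_int n n

/-- h_{k+1}' -/
lemma hermiteFun_hasDeriv2 (n : ℕ) (x : ℝ) :
    HasDerivAt (hermiteFun (n+1)) (-x * hermiteFun (n+1) x + Real.sqrt (2 * (n+1)) * hermiteFun n x) x := by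
  refine (hermiteFun_hasDeriv (n+1) x).congr_deriv ?_
  have := hermiteFun_rec n x
  push_cast
  rw [show (n:ℝ)+1+1 = n + 2 by ring, show n + 1 + 1 = n + 2 by ring]
  linarith

lemma hsq_integral (n : ℕ) : ∫ x : ℝ, hermiteFun n x ^ 2 = 1 := by
  induction n with
  | zero =>
    simp only [hermiteFun_zero_sq]
    rw [integral_div]
    have := integral_gaussian 1
    simp only [neg_mul, one_mul, div_one] at this
    rw [this]
    have := Real.pi_pos
    exact div_self (by positivity)
  | succ n ih =>
    have hs : 0 < Real.sqrt (2 * (n+1:ℝ)) := by positivity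
    have hd : ∀ x, HasDerivAt (fun x => hermiteFun n x * hermiteFun (n+1) x)
        (Real.sqrt (2 * (n+1:ℝ)) * (hermiteFun n x ^ 2 - hermiteFun (n+1) x ^ 2)) x := by
      intro x
      refine ((hermiteFun_hasDeriv n x).mul (hermiteFun_hasDeriv2 n x)).congr_deriv ?_
      ring
    have h0 := integral_eq_zero_of_hasDerivAt_of_integrable hd
      (((hsq_int n).sub (hsq_int (n+1))).const_mul _) (hmul_int n (n+1))
    rw [integral_const_mul, integral_sub (hsq_int n) (hsq_int (n+1)), ih] at h0
    rcases mul_eq_zero.1 h0 with h | h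
    · exact absurd h hs.ne'
    · linarith

lemma eSpec_cont (d n : ℕ) : Continuous (eSpec d n) := by
  unfold eSpec
  have := hermiteFun_cont
  fun_prop

lemma eSpec_lint (d n : ℕ) : ∫⁻ x : Fin (d+1) → ℝ, ENNReal.ofReal (eSpec (d+1) n x) = Ddim (d+1) n := by
  have hi : ∀ i ∈ Finset.Nat.antidiagonalTuple (d+1) n,
      Integrable (fun x : Fin (d+1) → ℝ => ∏ k, (hermiteFun (i k) (x k)) ^ 2) := by
    intro i _
    exact Integrable.fintype_prod (f := fun k t => (hermiteFun (i k) t)^2) (fun k => hsq_int (i k))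
  have hI : Integrable (fun x => eSpec (d+1) n x) := integrable_finsetSum _ hi
  rw [← ofReal_integral_eq_lintegral_ofReal hI (ae_of_all _ (eSpec_nonneg _ _))]
  unfold eSpec
  rw [integral_finsetSum _ hi]
  have : ∀ i ∈ Finset.Nat.antidiagonalTuple (d+1) n,
      ∫ x : Fin (d+1) → ℝ, ∏ k, (hermiteFun (i k) (x k)) ^ 2 = 1 := by
    intro i _
    rw [integral_fintype_prod_volume_eq_prod (f := fun k t => (hermiteFun (i k) t)^2)]
    simp [hsq_integral]
  rw [Finset.sum_congr rfl this]
  simp [card_aT]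

lemma g_lint (d : ℕ) (hd : 2 ≤ d) (n : ℕ) :
    ∫⁻ x : Fin d → ℝ, ENNReal.ofReal (eSpec d n x / Ddim d n) = 1 := by
  obtain ⟨d, rfl⟩ := Nat.exists_eq_add_of_le' hd
  have hp := Ddim_pos d n
  simp_rw [ENNReal.ofReal_div_of_pos hp]
  simp_rw [div_eq_mul_inv]
  rw [lintegral_mul_const _ (by have := eSpec_cont (d+2) n; fun_prop), eSpec_lint]
  rw [ENNReal.ofReal_natCast]
  apply ENNReal.mul_inv_cancel
  · exact_mod_cast hp.ne'
  · simp

end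

section
open MeasureTheory Filter Topology
open scoped ENNReal NNReal

lemma hump_choose {α : Type*} [MeasurableSpace α] (μ : Measure α) [SigmaFinite μ] (q : ℝ) (hq : 1 < q)
    (w : ℕ → α → ℝ≥0∞) (hw : ∀ n, Measurable (w n)) (B : ℝ≥0∞) (hB : B ≠ ⊤)
    (hwB : ∀ n, ∫⁻ x, w n x ^ q ∂μ ≤ B) (ε : ℕ → ℝ≥0∞) (hε : Tendsto ε atTop (𝓝 0))
    (hwe : ∀ n x, w n x ≤ ε n) (c η : ℝ≥0∞) (hc : c ≠ ⊤) (hη : 0 < η) (m M : ℕ) :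
    ∃ n N : ℕ, m < n ∧ M ≤ N ∧
      ∫⁻ x in (spanningSets μ N \ spanningSets μ M)ᶜ, (c * w n x) ^ q ∂μ ≤ η := by
  have hη2 : 0 < η / 2 := ENNReal.half_pos hη.ne'
  have hq0 : 0 < q := by linarith
  have t1 : Tendsto (fun n => (c * ε n) ^ q * μ (spanningSets μ M)) atTop (𝓝 0) := by
    have a1 : Tendsto (fun n => c * ε n) atTop (𝓝 (c * 0)) := ENNReal.Tendsto.const_mul hε (Or.inr hc)
    have a2 := ((ENNReal.continuous_rpow_const (y := q)).tendsto _).comp a1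
    have a3 := ENNReal.Tendsto.mul_const (b := μ (spanningSets μ M)) a2
      (Or.inr (measure_spanningSets_lt_top μ M).ne)
    simpa [ENNReal.zero_rpow_of_pos hq0] using a3
  obtain ⟨n, hn1, hn2⟩ := ((t1.eventually (gt_mem_nhds hη2)).and (eventually_gt_atTop m)).exists
  have hmeas : Measurable (fun x => (c * w n x) ^ q) := by
    have := hw n; fun_prop
  have hfin : ∫⁻ x, (c * w n x) ^ q ∂μ ≠ ⊤ := by
    simp_rw [ENNReal.mul_rpow_of_nonneg _ _ hq0.le]
    rw [lintegral_const_mul _ (by have := hw n; fun_prop)]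
    exact ENNReal.mul_ne_top (ENNReal.rpow_ne_top_of_nonneg hq0.le hc) ((hwB n).trans_lt hB.lt_top).ne
  have t2 : Tendsto (fun N => ∫⁻ x in (spanningSets μ N)ᶜ, (c * w n x) ^ q ∂μ) atTop (𝓝 0) := by
    have := tendsto_measure_iInter_atTop (μ := μ.withDensity (fun x => (c * w n x) ^ q))
      (s := fun N => (spanningSets μ N)ᶜ)
      (fun N => (measurableSet_spanningSets μ N).compl.nullMeasurableSet)
      (fun a b hab => Set.compl_subset_compl.2 (monotone_spanningSets μ hab))
      ⟨0, by
        rw [withDensity_apply _ (measurableSet_spanningSets μ 0).compl]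
        exact ((setLIntegral_le_lintegral _ _).trans_lt hfin.lt_top).ne⟩
    rw [← Set.compl_iUnion, iUnion_spanningSets] at this
    simp only [Set.compl_univ, measure_empty] at this
    refine this.congr fun N => ?_
    simp only [Function.comp]
    rw [withDensity_apply _ (measurableSet_spanningSets μ N).compl]
  obtain ⟨N, hN1, hN2⟩ := ((t2.eventually (gt_mem_nhds hη2)).and (eventually_ge_atTop M)).exists
  refine ⟨n, N, hn2, hN2, ?_⟩
  rw [Set.compl_sdiff, Set.union_comm]
  refine (lintegral_union_le _ _ _).trans ?_
  rw [← ENNReal.add_halves η]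
  refine add_le_add hN1.le (le_trans ?_ hn1.le)
  calc ∫⁻ x in spanningSets μ M, (c * w n x) ^ q ∂μ ≤ ∫⁻ x in spanningSets μ M, (c * ε n) ^ q ∂μ := by
        apply lintegral_mono; intro x
        exact ENNReal.rpow_le_rpow (by gcongr; exact hwe n x) hq0.le
    _ = _ := by rw [setLIntegral_const]

lemma tsum_rpow_sup (q : ℝ) (hq : 0 < q) (u : ℕ → ℝ≥0∞) :
    (∑' k, (2⁻¹ : ℝ≥0∞)^(k+1) * u k) ^ q ≤ ∑' k, u k ^ q := by
  have h1 : ∀ k, u k ≤ (∑' k, u k ^ q) ^ q⁻¹ := fun k => by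
    rw [ENNReal.le_rpow_inv_iff hq]; exact ENNReal.le_tsum k
  have h2 : ∑' k, (2⁻¹ : ℝ≥0∞)^(k+1) * u k ≤ (∑' k, u k ^ q) ^ q⁻¹ := by
    calc _ ≤ ∑' k, (2⁻¹ : ℝ≥0∞)^(k+1) * (∑' k, u k ^ q) ^ q⁻¹ := by
          gcongr with k; exact h1 k
      _ = _ := by
          rw [ENNReal.tsum_mul_right, ENNReal.tsum_geometric_add_one, ENNReal.one_sub_inv_two, inv_inv,
            ENNReal.inv_mul_cancel (by simp) (by simp), one_mul]
  rwa [ENNReal.le_rpow_inv_iff hq] at h2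

lemma hump {α : Type*} [MeasurableSpace α] (μ : Measure α) [SigmaFinite μ] (q : ℝ) (hq : 1 < q)
    (w : ℕ → α → ℝ≥0∞) (hw : ∀ n, Measurable (w n)) (B : ℝ≥0∞) (hB : B ≠ ⊤)
    (hwB : ∀ n, ∫⁻ x, w n x ^ q ∂μ ≤ B) (ε : ℕ → ℝ≥0∞) (hε : Tendsto ε atTop (𝓝 0))
    (hwe : ∀ n x, w n x ≤ ε n) :
    ∃ I : Set ℕ, I.Infinite ∧ ∀ a : ℕ → ℝ≥0∞, (∀ n ∉ I, a n = 0) → ∑' n, a n ^ q < ⊤ →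
      ∫⁻ x, (∑' n, a n * w n x) ^ q ∂μ < ⊤ := by
  have hq0 : 0 < q := by linarith
  have hch : ∀ k m M : ℕ, ∃ n N : ℕ, m < n ∧ M ≤ N ∧
      ∫⁻ x in (spanningSets μ N \ spanningSets μ M)ᶜ, ((2:ℝ≥0∞)^(k+1) * w n x) ^ q ∂μ ≤ (2⁻¹)^(k+1) := 
    fun k m M => hump_choose μ q hq w hw B hB hwB ε hε hwe _ _ (by simp) 
      (ENNReal.pow_pos (by simp) _) m M
  choose f g hfg using hch
  let st : ℕ → ℕ × ℕ := fun k => Nat.rec (0, 0) (fun k s => (f k s.1 s.2, g k s.1 s.2)) k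
  have st_succ : ∀ k, st (k+1) = (f k (st k).1 (st k).2, g k (st k).1 (st k).2) := fun k => rfl
  have hst : ∀ k, (st k).1 < (st (k+1)).1 ∧ (st k).2 ≤ (st (k+1)).2 ∧ 
    ∫⁻ x in (spanningSets μ (st (k+1)).2 \ spanningSets μ (st k).2)ᶜ,
      ((2:ℝ≥0∞)^(k+1) * w (st (k+1)).1 x) ^ q ∂μ ≤ (2⁻¹)^(k+1) := fun k => by
    rw [st_succ]; exact hfg k _ _
  have hmono1 : StrictMono (fun k => (st k).1) := strictMono_nat_of_lt_succ fun k => (hst k).1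
  have hmono2 : Monotone (fun k => (st k).2) := monotone_nat_of_le_succ fun k => (hst k).2.1
  let nn : ℕ → ℕ := fun k => (st (k+1)).1
  have hnn : StrictMono nn := fun a b hab => hmono1 (Nat.add_lt_add_right hab 1)
  let G : ℕ → Set α := fun k => spanningSets μ (st (k+1)).2 \ spanningSets μ (st k).2
  have hGm : ∀ k, MeasurableSet (G k) := fun k => 
    (measurableSet_spanningSets μ _).diff (measurableSet_spanningSets μ _)
  have hGd : ∀ j k x, j < k → x ∈ G j → x ∉ G k := by
    intro j k x hjk hj hk
    exact hk.2 (monotone_spanningSets μ (hmono2 (by omega : j + 1 ≤ k)) hj.1)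
  have hGc : ∀ k, ∫⁻ x in (G k)ᶜ, ((2:ℝ≥0∞)^(k+1) * w (nn k) x) ^ q ∂μ ≤ (2⁻¹)^(k+1) := fun k => (hst k).2.2
  clear_value nn G
  refine ⟨Set.range nn, Set.infinite_range_of_injective hnn.injective, fun a ha hsum => ?_⟩
  -- the constant bounding the coefficients
  set S := ∑' n, a n ^ q with hS
  have haA : ∀ n, a n ≤ S ^ q⁻¹ := fun n => by
    rw [ENNReal.le_rpow_inv_iff hq0]; exact ENNReal.le_tsum n
  have hA : S ^ q⁻¹ ≠ ⊤ := ENNReal.rpow_ne_top_of_nonneg (by positivity) hsum.ne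
  set A := S ^ q⁻¹
  have hS2 : ∑' k, a (nn k) ^ q ≤ S := ENNReal.tsum_comp_le_tsum_of_injective hnn.injective _
  have hre : ∀ x, ∑' n, a n * w n x = ∑' k, a (nn k) * w (nn k) x := by
    intro x
    symm
    apply hnn.injective.tsum_eq (f := fun n => a n * w n x)
    intro n hn
    by_contra h
    exact hn (by simp [ha n h])
  -- pointwise bound
  have hpt : ∀ x, (∑' n, a n * w n x) ^ q ≤ (2:ℝ≥0∞)^(q-1) *
      (∑' k, a (nn k) ^ q * w (nn k) x ^ q + 
       A ^ q * ∑' k, (G k)ᶜ.indicator (fun x => ((2:ℝ≥0∞)^(k+1) * w (nn k) x) ^ q) x) := by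
    intro x
    have e : ∑' n, a n * w n x = ∑' k, (G k).indicator (fun x => a (nn k) * w (nn k) x) x +
        ∑' k, (G k)ᶜ.indicator (fun x => a (nn k) * w (nn k) x) x := by
      rw [hre, ← ENNReal.tsum_add]
      congr 1; ext k
      have := congrFun (Set.indicator_self_add_compl (G k) (fun x => a (nn k) * w (nn k) x)) x
      exact this.symm
    rw [e]
    refine (ENNReal.rpow_add_le_mul_rpow_add_rpow _ _ hq.le).trans ?_
    gcongr
    · by_cases hx : ∃ k, x ∈ G k
      · obtain ⟨k, hk⟩ := hx
        rw [tsum_eq_single k]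
        · rw [Set.indicator_of_mem hk, ENNReal.mul_rpow_of_nonneg _ _ hq0.le]
          exact ENNReal.le_tsum (f := fun k => a (nn k) ^ q * w (nn k) x ^ q) k
        · intro j hj
          apply Set.indicator_of_notMem
          rcases lt_or_gt_of_ne hj with h | h
          · intro hh; exact hGd j k x h hh hk
          · exact hGd k j x h hk
      · push Not at hx
        have : ∑' k, (G k).indicator (fun x => a (nn k) * w (nn k) x) x = 0 := by
          rw [ENNReal.tsum_eq_zero]; intro k; exact Set.indicator_of_notMem (hx k) _
        rw [this, ENNReal.zero_rpow_of_pos hq0]; exact bot_le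
    · have h1 : ∑' k, (G k)ᶜ.indicator (fun x => a (nn k) * w (nn k) x) x ≤
          A * ∑' k, (2⁻¹ : ℝ≥0∞)^(k+1) * (G k)ᶜ.indicator (fun x => (2:ℝ≥0∞)^(k+1) * w (nn k) x) x := by
        rw [← ENNReal.tsum_mul_left]
        gcongr with k
        by_cases hx : x ∈ (G k)ᶜ
        · rw [Set.indicator_of_mem hx, Set.indicator_of_mem hx, ← mul_assoc (2⁻¹ ^ (k+1)), ← mul_pow,
            ENNReal.inv_mul_cancel (by simp) (by simp), one_pow, one_mul]
          gcongr; exact haA _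
        · rw [Set.indicator_of_notMem hx]; exact bot_le
      refine (ENNReal.rpow_le_rpow h1 hq0.le).trans ?_
      rw [ENNReal.mul_rpow_of_nonneg _ _ hq0.le]
      gcongr
      refine (tsum_rpow_sup q hq0 _).trans (le_of_eq ?_)
      congr 1; ext k
      by_cases hx : x ∈ (G k)ᶜ
      · rw [Set.indicator_of_mem hx, Set.indicator_of_mem hx]
      · rw [Set.indicator_of_notMem hx, Set.indicator_of_notMem hx, ENNReal.zero_rpow_of_pos hq0]
  refine (lintegral_mono hpt).trans_lt ?_
  have m1 : ∀ k, Measurable (fun x => a (nn k) ^ q * w (nn k) x ^ q) := fun k => by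
    have := hw (nn k); fun_prop
  have m2 : ∀ k, Measurable (fun x => (G k)ᶜ.indicator (fun x => ((2:ℝ≥0∞)^(k+1) * w (nn k) x) ^ q) x) := fun k => by
    refine Measurable.indicator ?_ (hGm k).compl
    have := hw (nn k); fun_prop
  have m3 : Measurable (fun x => ∑' k, a (nn k) ^ q * w (nn k) x ^ q) := Measurable.tsum m1
  have m4 : Measurable (fun x => ∑' k, (G k)ᶜ.indicator (fun x => ((2:ℝ≥0∞)^(k+1) * w (nn k) x) ^ q) x) :=
    Measurable.tsum m2
  rw [lintegral_const_mul' _ _ (ENNReal.rpow_lt_top_of_nonneg (by linarith) (by simp)).ne,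
    lintegral_add_left m3, lintegral_const_mul _ m4,
    lintegral_tsum (fun k => (m1 k).aemeasurable), lintegral_tsum (fun k => (m2 k).aemeasurable)]
  have b1 : ∑' k, ∫⁻ x, a (nn k) ^ q * w (nn k) x ^ q ∂μ ≤ S * B := by
    calc _ ≤ ∑' k, a (nn k) ^ q * B := by
          gcongr with k
          rw [lintegral_const_mul _ (by have := hw (nn k); fun_prop)]
          gcongr; exact hwB _
      _ ≤ S * B := by rw [ENNReal.tsum_mul_right]; gcongr
  have b2 : ∑' k, ∫⁻ x, (G k)ᶜ.indicator (fun x => ((2:ℝ≥0∞)^(k+1) * w (nn k) x) ^ q) x ∂μ ≤ 1 := by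
    calc _ ≤ ∑' k : ℕ, (2⁻¹ : ℝ≥0∞)^(k+1) := by
          gcongr with k
          rw [lintegral_indicator (hGm k).compl]; exact hGc k
      _ = 1 := by
          rw [ENNReal.tsum_geometric_add_one, ENNReal.one_sub_inv_two, inv_inv,
            ENNReal.inv_mul_cancel (by simp) (by simp)]
  refine ENNReal.mul_lt_top (ENNReal.rpow_lt_top_of_nonneg (by linarith) (by simp)) ?_
  refine ENNReal.add_lt_top.2 ⟨b1.trans_lt (ENNReal.mul_lt_top hsum hB.lt_top), 
    ENNReal.mul_lt_top (ENNReal.rpow_lt_top_of_nonneg hq0.le hA) (b2.trans_lt (by simp))⟩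

end

open MeasureTheory Filter Topology
open scoped ENNReal NNReal

/-- Proposition 25.1: there is an exponent `r(p) > 1` and an infinite set
`I ⊆ ℕ` such that, for sequences supported in `I`, the `ℓ^r` summability of
`(1+n)^{−d(1/2−1/p)} c_n²` guarantees membership in the probabilistic Lebesgue space. -/
theorem stmt15 (d : ℕ) (hd : 2 ≤ d) (p : ℝ) (hp : 2 < p) :
    ∃ r : ℝ, 1 < r ∧
      ∃ I : Set ℕ, I.Infinite ∧
        ∀ c : ℕ → ℝ, (∀ n, 0 ≤ c n) → (∀ n ∉ I, c n = 0) →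
          (∑' n : ℕ, (((1 + n : ℕ) : ℝ≥0∞) ^ (-(d : ℝ) * (1 / 2 - 1 / p)) *
              ENNReal.ofReal ((c n) ^ 2)) ^ r) < ⊤ →
          hermitePLnorm d p c < ⊤ := by
  have hp0 : 0 < p := by linarith
  have hd0 : (0:ℝ) < d := by exact_mod_cast (by omega : 0 < d)
  obtain ⟨K, hK, hg⟩ := g_bound d hd
  set s : ℝ := (d:ℝ) * (1/2 - 1/p) with hs
  let w : ℕ → (Fin d → ℝ) → ℝ≥0∞ := fun n x => ENNReal.ofReal (((n:ℝ)+1)^s * (eSpec d n x / Ddim d n))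
  let ε : ℕ → ℝ≥0∞ := fun n => ENNReal.ofReal (K * ((n:ℝ)+1)^(-((d:ℝ)/p)))
  have hg0 : ∀ n x, 0 ≤ eSpec d n x / Ddim d n := fun n x => div_nonneg (eSpec_nonneg _ _ _) (by positivity)
  have hwm : ∀ n, Measurable (w n) := fun n => by
    have := (eSpec_cont d n).measurable
    fun_prop
  have hwe : ∀ n x, w n x ≤ ε n := by
    intro n x
    apply ENNReal.ofReal_le_ofReal
    have hn : (0:ℝ) < n + 1 := by positivity
    calc _ ≤ ((n:ℝ)+1)^s * (K * ((n:ℝ)+1) ^ (-(d:ℝ)/2)) := by gcongr; exact hg n x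
      _ = K * (((n:ℝ)+1)^s * ((n:ℝ)+1) ^ (-(d:ℝ)/2)) := by ring
      _ = _ := by
        rw [← Real.rpow_add hn]; congr 2; rw [hs]; ring
  have hε : Tendsto ε atTop (𝓝 0) := by
    have h1 : Tendsto (fun n : ℕ => ((n:ℝ)+1)) atTop atTop :=
      tendsto_atTop_add_const_right _ _ tendsto_natCast_atTop_atTop
    have h2 := ((tendsto_rpow_neg_atTop (y := (d:ℝ)/p) (by positivity)).comp h1).const_mul K
    have h3 := (ENNReal.continuous_ofReal.tendsto _).comp h2
    simp only [mul_zero, ENNReal.ofReal_zero] at h3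
    exact h3
  have hwB : ∀ n, ∫⁻ x, w n x ^ (p/2) ≤ ENNReal.ofReal (K ^ (p/2-1)) := by
    intro n
    have hn : (0:ℝ) < n + 1 := by positivity
    have hpt : ∀ x, w n x ^ (p/2) ≤ ENNReal.ofReal (K ^ (p/2-1)) * ENNReal.ofReal (eSpec d n x / Ddim d n) := by
      intro x
      have e1 : w n x ^ (p/2) = w n x ^ (p/2 - 1) * w n x := by
        conv_rhs => rw [← ENNReal.rpow_one (w n x), ← ENNReal.rpow_mul, one_mul]
        rw [← ENNReal.rpow_add_of_nonneg _ _ (by linarith) (by norm_num)]; congr 1; ring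
      rw [e1]
      calc _ ≤ ε n ^ (p/2-1) * w n x := by
            gcongr
            · linarith
            · exact hwe n x
        _ = ENNReal.ofReal (K ^ (p/2-1)) * ENNReal.ofReal (eSpec d n x / Ddim d n) := by
            simp only [ε, w]
            rw [ENNReal.ofReal_rpow_of_pos (by positivity), ← ENNReal.ofReal_mul (by positivity),
              ← ENNReal.ofReal_mul (by positivity)]
            congr 1
            rw [Real.mul_rpow hK.le (by positivity), ← Real.rpow_mul hn.le]
            have : ((n:ℝ)+1) ^ (-((d:ℝ)/p) * (p/2-1)) * ((n:ℝ)+1)^s = 1 := by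
              rw [← Real.rpow_add hn, hs]
              convert Real.rpow_zero _ using 2
              field_simp; ring
            linear_combination K ^ (p/2-1) * (eSpec d n x / Ddim d n) * this
    refine (lintegral_mono hpt).trans ?_
    rw [lintegral_const_mul _ (by have := (eSpec_cont d n).measurable; fun_prop), g_lint d hd n, mul_one]
  obtain ⟨I, hI, hmain⟩ := hump (volume : Measure (Fin d → ℝ)) (p/2) (by linarith) w hwm _
    ENNReal.ofReal_ne_top hwB ε hε hwe
  refine ⟨p/2, by linarith, I, hI, fun c hc hcI hsum => ?_⟩
  have hm := hmain (fun n => ((1 + n : ℕ) : ℝ≥0∞) ^ (-(d : ℝ) * (1 / 2 - 1 / p)) * ENNReal.ofReal ((c n) ^ 2))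
    (fun n hn => by simp [hcI n hn]) hsum
  unfold hermitePLnorm
  apply ENNReal.rpow_lt_top_of_nonneg (by positivity)
  refine ne_of_lt (lt_of_le_of_lt (le_of_eq ?_) hm)
  congr 1; ext x; congr 1; congr 1; ext n
  have hn : (0:ℝ) < n + 1 := by positivity
  have e : ((1 + n : ℕ) : ℝ≥0∞) ^ (-(d : ℝ) * (1 / 2 - 1 / p)) = ENNReal.ofReal (((n:ℝ)+1)^(-s)) := by
    rw [← ENNReal.ofReal_rpow_of_pos hn, ← ENNReal.ofReal_natCast]
    congr 2
    · push_cast; ring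
    · rw [hs]; ring
  simp only [w]
  rw [e, ← ENNReal.ofReal_mul (by positivity), ← ENNReal.ofReal_mul (by positivity)]
  congr 1
  have : ((n:ℝ)+1)^(-s) * ((n:ℝ)+1)^s = 1 := by
    rw [← Real.rpow_add hn]; simp
  linear_combination - (c n)^2 * (eSpec d n x / Ddim d n) * this
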